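/- arXiv:2208.02045 — 3 statements merged into one kernel-verified Lean document; each statement's English description precedes it below -/
import Mathlib

section
/- Let H₁ and H₂ be graphs, p₁, p₂ ∈ (0,1) with p₁+p₂=1, and suppose the girth g(H₂) is odd and (H₁,H₂) is (p₁,p₂)-common. Then either g(H₁) < g(H₂), or g(H₁) = g(H₂) = k and c_k(H₁)/(e(H₁)·p₁^{k-1}) = c_k(H₂)/(e(H₂)·p₂^{k-1}). -/
open MeasureTheory Finset

/-- The uniform measure on the unit interval `[0,1]`, as a measure on `ℝ`. -/
noncomputable def unitM : Measure ℝ := volume.restrict (Set.Icc 0 1)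

instance : SigmaFinite unitM := by unfold unitM; infer_instance

/-- Value of a symmetric two-variable function on an unordered pair of vertices. -/
noncomputable def symEdge {α : Type*} (W : ℝ → ℝ → ℝ) (x : α → ℝ) : Sym2 α → ℝ :=
  Sym2.lift ⟨fun u v => (W (x u) (x v) + W (x v) (x u)) / 2, fun u v => by ring⟩

open Classical in
/-- Homomorphism density of a finite simple graph in a kernel. -/
noncomputable def homDensity {V : Type*} [Fintype V] (G : SimpleGraph V)
    (W : ℝ → ℝ → ℝ) : ℝ :=
  ∫ x : V → ℝ, ∏ e ∈ G.edgeFinset, symEdge W x e ∂(Measure.pi fun _ => unitM)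

/-- Number of edges of a graph. -/
noncomputable def eCount {V : Type*} (G : SimpleGraph V) : ℕ := G.edgeSet.ncard

def IsSymm2 (W : ℝ → ℝ → ℝ) : Prop := ∀ x y, W x y = W y x

/-- A kernel: bounded, symmetric, measurable. -/
def IsKernel (W : ℝ → ℝ → ℝ) : Prop :=
  Measurable (Function.uncurry W) ∧ IsSymm2 W ∧ ∃ C, ∀ x y, |W x y| ≤ C

/-- A graphon: symmetric measurable with values in `[0,1]`. -/
def IsGraphon (W : ℝ → ℝ → ℝ) : Prop :=
  Measurable (Function.uncurry W) ∧ IsSymm2 W ∧ ∀ x y, W x y ∈ Set.Icc (0:ℝ) 1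

/-- The pair `(G₁, G₂)` is `(p₁,p₂)`-common. -/
def IsCommonPair {V₁ V₂ : Type*} [Fintype V₁] [Fintype V₂]
    (G₁ : SimpleGraph V₁) (G₂ : SimpleGraph V₂) (p₁ p₂ : ℝ) : Prop :=
  ∀ W₁ W₂ : ℝ → ℝ → ℝ, IsGraphon W₁ → IsGraphon W₂ → (∀ x y, W₁ x y + W₂ x y = 1) →
    homDensity G₁ W₁ / (eCount G₁ * p₁ ^ (eCount G₁ - 1))
      + homDensity G₂ W₂ / (eCount G₂ * p₂ ^ (eCount G₂ - 1))
      ≥ p₁ / eCount G₁ + p₂ / eCount G₂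

/-- The number of (unlabelled) cycles of length `k` in `G`, i.e. the number of
subgraphs of `G` isomorphic to `C_k`. -/
noncomputable def cycleCount {V : Type*} (k : ℕ) (G : SimpleGraph V) : ℕ :=
  Nat.card {H' : G.Subgraph // Nonempty (H'.coe ≃g SimpleGraph.cycleGraph k)}

section EvenEdgeSets

open SimpleGraph Classical

/-- A finite acyclic graph with at least one edge has a leaf. -/
theorem SimpleGraph.IsAcyclic.exists_existsUnique_adj {V : Type*} [Finite V]
    {G : SimpleGraph V} (h : G.IsAcyclic) {a b : V} (hab : G.Adj a b) :
    ∃ v, ∃! w, G.Adj v w := by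
  have : Nonempty V := ⟨a⟩
  obtain ⟨u, v, p, hp, hmax⟩ := Walk.exists_isPath_forall_isPath_length_le_length G
  have h1 := hmax a b hab.toWalk (by simp [hab.ne])
  have hnil : ¬p.Nil := by
    intro h0
    rw [← Walk.length_eq_zero_iff] at h0
    simp [h0] at h1
  refine ⟨u, _, p.adj_snd hnil, fun w hadj ↦ ?_⟩
  apply h.eq_snd_of_adj_start hp hadj
  have : ¬(p.cons hadj.symm).IsPath := by grind [Walk.length_cons]
  grind [hp.cons]

theorem card_filter_mem_edgeFinset {V : Type*} (G : SimpleGraph V) (v : V) [Fintype (G.neighborSet v)]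
    [Fintype G.edgeSet] :
    #{e ∈ G.edgeFinset | v ∈ e} = G.degree v := by
  rw [← card_incidenceFinset_eq_degree, incidenceFinset_eq_filter]

/-- Every vertex is incident to an even number of the edges in `F`. -/
def IsEvenEdgeSet {V : Type*} (F : Finset (Sym2 V)) : Prop :=
  ∀ v, Even #{e ∈ F | v ∈ e}

/-- The sets of `n` edges of `G` in which every vertex has even degree. -/
noncomputable def evenEdgeSets {V : Type*} [Fintype V] (G : SimpleGraph V) (n : ℕ) :
    Finset (Finset (Sym2 V)) :=
  {F ∈ powersetCard n G.edgeFinset | IsEvenEdgeSet F}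

variable {V : Type*} [Fintype V] {G : SimpleGraph V}

theorem edgeFinset_fromEdgeSet_of_subset {F : Finset (Sym2 V)} (hF : F ⊆ G.edgeFinset)
    [Fintype (fromEdgeSet (F : Set (Sym2 V))).edgeSet] :
    (fromEdgeSet (F : Set (Sym2 V))).edgeFinset = F := by
  ext e
  have : e ∈ F → ¬ e.IsDiag := fun he => G.not_isDiag_of_mem_edgeFinset (hF he)
  simpa using this

theorem exists_isCycle_of_isEvenEdgeSet {F : Finset (Sym2 V)} (hF : F ⊆ G.edgeFinset)
    (hne : F.Nonempty) (heven : IsEvenEdgeSet F) :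
    ∃ (v : V) (c : (fromEdgeSet (F : Set (Sym2 V))).Walk v v), c.IsCycle ∧ c.length ≤ #F := by
  have hedge := edgeFinset_fromEdgeSet_of_subset hF
  have hcyc : ¬ (fromEdgeSet (F : Set (Sym2 V))).IsAcyclic := by
    intro hac
    obtain ⟨e, he⟩ := hne
    rw [← hedge, mem_edgeFinset] at he
    induction e with | h a b =>
    obtain ⟨v, hv⟩ := hac.exists_existsUnique_adj he
    rw [← degree_eq_one_iff_existsUnique_adj, ← card_filter_mem_edgeFinset, hedge] at hv
    have := heven v
    simp [hv] at this
  simp only [IsAcyclic, not_forall, not_not] at hcyc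
  obtain ⟨v, c, hc⟩ := hcyc
  refine ⟨v, c, hc, ?_⟩
  convert hc.isTrail.length_le_card_edgeFinset
  exact hedge.symm

theorem fromEdgeSet_le_of_subset {F : Finset (Sym2 V)} (hF : F ⊆ G.edgeFinset) :
    fromEdgeSet (F : Set (Sym2 V)) ≤ G := by
  rw [← edgeFinset_subset_edgeFinset, edgeFinset_fromEdgeSet_of_subset hF]
  exact hF

theorem egirth_le_card_of_isEvenEdgeSet {F : Finset (Sym2 V)} (hF : F ⊆ G.edgeFinset)
    (hne : F.Nonempty) (heven : IsEvenEdgeSet F) : G.egirth ≤ #F := by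
  obtain ⟨v, c, hc, hlen⟩ := exists_isCycle_of_isEvenEdgeSet hF hne heven
  calc G.egirth ≤ (c.mapLe (fromEdgeSet_le_of_subset hF)).length :=
        egirth_le_length (hc.mapLe _)
    _ ≤ #F := by simpa using hlen

theorem card_evenEdgeSets_zero (G : SimpleGraph V) : #(evenEdgeSets G 0) = 1 := by
  simp [evenEdgeSets, IsEvenEdgeSet, Finset.filter_singleton]

theorem evenEdgeSets_eq_empty_of_card_lt {n : ℕ} (hn : #G.edgeFinset < n) :
    evenEdgeSets G n = ∅ := by
  simp [evenEdgeSets, Finset.powersetCard_eq_empty.2 hn]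

theorem evenEdgeSets_eq_empty_of_lt_egirth {n : ℕ} (hn : n ≠ 0) (hg : (n : ℕ∞) < G.egirth) :
    evenEdgeSets G n = ∅ := by
  ext F
  simp only [evenEdgeSets, mem_filter, mem_powersetCard, notMem_empty, iff_false]
  rintro ⟨⟨hF, rfl⟩, heven⟩
  have hne : F.Nonempty := Finset.card_ne_zero.1 hn
  exact absurd hg (not_lt.2 (egirth_le_card_of_isEvenEdgeSet hF hne heven))

theorem subgraph_degree_of_iso_cycleGraph {k : ℕ} (hk : 3 ≤ k) {H : G.Subgraph}
    (f : H.coe ≃g cycleGraph k) (v : V) : H.degree v = if v ∈ H.verts then 2 else 0 := by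
  obtain ⟨k, rfl⟩ := Nat.exists_eq_add_of_le' hk
  split_ifs with hv
  · rw [← H.coe_degree ⟨v, hv⟩, ← f.degree_eq]
    convert cycleGraph_degree_three_le
  · exact Subgraph.degree_of_notMem_verts hv

theorem toFinset_edgeSet_mem_evenEdgeSets {k : ℕ} (hk : 3 ≤ k) {H : G.Subgraph}
    (f : H.coe ≃g cycleGraph k) : H.edgeSet.toFinset ∈ evenEdgeSets G k := by
  have hdeg (v : V) : #{e ∈ H.edgeSet.toFinset | v ∈ e} = if v ∈ H.verts then 2 else 0 := by
    rw [← subgraph_degree_of_iso_cycleGraph hk f, ← Subgraph.degree_spanningCoe,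
      ← card_filter_mem_edgeFinset]
    congr 2
    ext; simp
  simp only [evenEdgeSets, mem_filter, mem_powersetCard]
  refine ⟨⟨?_, ?_⟩, fun v => ?_⟩
  · intro e he
    exact mem_edgeFinset.2 (H.edgeSet_subset (by simpa using he))
  · have hverts : #H.verts.toFinset = k := by
      rw [Set.toFinset_card, Fintype.card_congr f.toEquiv, Fintype.card_fin]
    have h := H.spanningCoe.sum_degrees_eq_twice_card_edges
    have h2 : H.spanningCoe.edgeFinset = H.edgeSet.toFinset := by ext; simp
    rw [h2] at h
    simp only [Subgraph.degree_spanningCoe, subgraph_degree_of_iso_cycleGraph hk f] at h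
    rw [← Finset.sum_filter, Finset.sum_const, smul_eq_mul] at h
    have h3 : ({v | v ∈ H.verts} : Finset V) = H.verts.toFinset := by ext; simp
    rw [h3, hverts] at h
    omega
  · rw [hdeg]
    split_ifs <;> simp

/-- In a graph of girth at least `k`, the even edge sets of size `k` are the `k`-cycles. -/
theorem card_evenEdgeSets_eq_cycleCount {k : ℕ} (hk : 3 ≤ k) (hg : (k : ℕ∞) ≤ G.egirth) :
    #(evenEdgeSets G k) = cycleCount k G := by
  rw [cycleCount, ← Nat.card_eq_finsetCard]
  symm
  refine Nat.card_eq_of_bijective (fun H => ⟨H.1.edgeSet.toFinset,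
    toFinset_edgeSet_mem_evenEdgeSets hk H.2.some⟩) ⟨?_, ?_⟩
  · rintro ⟨H, ⟨f⟩⟩ ⟨H', ⟨f'⟩⟩ h
    simp only [Subtype.mk.injEq, Set.toFinset_inj] at h ⊢
    have hadj (v w : V) : H.Adj v w ↔ H'.Adj v w := by
      rw [← Subgraph.mem_edgeSet, h, Subgraph.mem_edgeSet]
    have hnbr (v : V) : H.degree v = H'.degree v := by
      rw [← Subgraph.degree_spanningCoe, ← Subgraph.degree_spanningCoe]
      congr! 1
      ext; simp [hadj]
    refine Subgraph.ext ?_ (by ext; exact hadj _ _)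
    ext v
    have := hnbr v
    rw [subgraph_degree_of_iso_cycleGraph hk f, subgraph_degree_of_iso_cycleGraph hk f'] at this
    split_ifs at this <;> simp_all
  · rintro ⟨F, hF⟩
    have hF' := hF
    simp only [evenEdgeSets, mem_filter, mem_powersetCard] at hF'
    obtain ⟨⟨hsub, hcard⟩, heven⟩ := hF'
    obtain ⟨v, c, hc, hlen⟩ := exists_isCycle_of_isEvenEdgeSet hsub
      (Finset.card_ne_zero.1 (by omega)) heven
    have hle := fromEdgeSet_le_of_subset hsub
    have hlen' : c.length = k := by
      have h1 := hg.trans (egirth_le_length (hc.mapLe hle))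
      rw [Walk.length_map] at h1
      exact le_antisymm (hlen.trans hcard.le) (by exact_mod_cast h1)
    obtain ⟨f⟩ := (cycleGraph_isContained_iff (by omega)).2 ⟨v, c, hc, hlen'⟩
    let g : Copy (cycleGraph k) G := (Copy.ofLE _ _ hle).comp f
    refine ⟨⟨g.toSubgraph, ⟨g.isoToSubgraph.symm⟩⟩, Subtype.ext ?_⟩
    change g.toSubgraph.edgeSet.toFinset = F
    have hmem := toFinset_edgeSet_mem_evenEdgeSets hk g.isoToSubgraph.symm
    simp only [evenEdgeSets, mem_filter, mem_powersetCard] at hmem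
    refine Finset.eq_of_subset_of_card_le ?_ (by rw [hcard, hmem.1.2])
    intro e he
    rw [← edgeFinset_fromEdgeSet_of_subset hsub, mem_edgeFinset]
    induction e with | h a b =>
    simp only [Set.mem_toFinset, Subgraph.mem_edgeSet, Copy.toSubgraph, Subgraph.map_adj,
      Relation.Map, Subgraph.top_adj] at he
    obtain ⟨x, y, hxy, rfl, rfl⟩ := he
    exact f.toHom.map_adj hxy

end EvenEdgeSets

section RankOne

/-- The function that is `1` on `(-∞, 1/2]` and `-1` on `(1/2, ∞)`. -/
noncomputable def halfSign (x : ℝ) : ℝ := if x ≤ 1 / 2 then 1 else -1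

theorem measurable_halfSign : Measurable halfSign :=
  Measurable.ite measurableSet_Iic measurable_const measurable_const

theorem halfSign_mul_self (x : ℝ) : halfSign x * halfSign x = 1 := by
  unfold halfSign; split_ifs <;> norm_num

theorem abs_halfSign (x : ℝ) : |halfSign x| = 1 := by
  unfold halfSign; split_ifs <;> norm_num

instance : IsProbabilityMeasure unitM := ⟨by simp [unitM]⟩

theorem integral_halfSign : ∫ x, halfSign x ∂unitM = 0 := by
  have h : halfSign = fun x => 2 * (Set.Iic (1 / 2 : ℝ)).indicator (fun _ => (1 : ℝ)) x - 1 := by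
    ext x
    by_cases hx : x ≤ 1 / 2
    · simp only [halfSign, Set.indicator, Set.mem_Iic, hx, if_true]; norm_num
    · simp only [halfSign, Set.indicator, Set.mem_Iic, hx, if_false]; norm_num
  rw [h, integral_sub, integral_const_mul, integral_indicator_const _ measurableSet_Iic]
  · have : Set.Iic (1 / 2 : ℝ) ∩ Set.Icc 0 1 = Set.Icc 0 (1 / 2) := by
      ext x; simp only [Set.mem_inter_iff, Set.mem_Iic, Set.mem_Icc]; constructor
      · rintro ⟨h1, h2, h3⟩; exact ⟨h2, h1⟩
      · rintro ⟨h1, h2⟩; exact ⟨h2, h1, by linarith⟩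
    have hm : unitM.real (Set.Iic (1 / 2 : ℝ)) = 1 / 2 := by
      rw [Measure.real, unitM, Measure.restrict_apply measurableSet_Iic, this]
      simp
    rw [hm]
    simp
  · exact ((integrable_const (1 : ℝ)).indicator measurableSet_Iic).const_mul 2
  · exact integrable_const _

theorem integral_halfSign_pow (n : ℕ) :
    ∫ x, halfSign x ^ n ∂unitM = if Even n then 1 else 0 := by
  have hsq (x : ℝ) : halfSign x ^ 2 = 1 := by rw [sq, halfSign_mul_self]
  split_ifs with h
  · obtain ⟨m, rfl⟩ := h
    simp [← two_mul, pow_mul, hsq]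
  · obtain ⟨m, rfl⟩ := Nat.not_even_iff_odd.1 h
    simp [pow_succ, pow_mul, hsq, integral_halfSign]

/-- The two-step kernel with value `p + ε` on the diagonal blocks and `p - ε` elsewhere. -/
noncomputable def twoBlock (p ε : ℝ) (x y : ℝ) : ℝ := p + ε * (halfSign x * halfSign y)

theorem isGraphon_twoBlock {p ε : ℝ} (h0 : |ε| ≤ p) (h1 : |ε| ≤ 1 - p) :
    IsGraphon (twoBlock p ε) := by
  refine ⟨?_, fun x y => by simp [twoBlock, mul_comm], fun x y => ?_⟩
  · have h1 := measurable_halfSign.comp (measurable_fst : Measurable (Prod.fst : ℝ × ℝ → ℝ))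
    have h2 := measurable_halfSign.comp (measurable_snd : Measurable (Prod.snd : ℝ × ℝ → ℝ))
    exact ((h1.mul h2).const_mul ε).const_add p
  · have : |ε * (halfSign x * halfSign y)| = |ε| := by simp [abs_mul, abs_halfSign]
    have h2 := abs_le.1 this.le
    exact ⟨by simp only [twoBlock]; linarith, by simp only [twoBlock]; linarith⟩

open Classical

variable {V : Type*} [Fintype V]

theorem symEdge_twoBlock (p ε : ℝ) (x : V → ℝ) {e : Sym2 V} (he : ¬ e.IsDiag) :
    symEdge (twoBlock p ε) x e = ε * (∏ v, if v ∈ e then halfSign (x v) else 1) + p := by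
  induction e with | h a b =>
  have hab : a ≠ b := by simpa using he
  have : ({v | v ∈ s(a, b)} : Finset V) = {a, b} := by ext; simp
  rw [← Finset.prod_filter, this, Finset.prod_pair hab]
  simp only [symEdge, Sym2.lift_mk, twoBlock]
  ring

theorem integral_prod_halfSign (F : Finset (Sym2 V)) :
    ∫ x : V → ℝ, ∏ e ∈ F, ∏ v, (if v ∈ e then halfSign (x v) else 1)
      ∂(Measure.pi fun _ => unitM) = if IsEvenEdgeSet F then 1 else 0 := by
  have (x : V → ℝ) : ∏ e ∈ F, ∏ v, (if v ∈ e then halfSign (x v) else 1)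
      = ∏ v, halfSign (x v) ^ #{e ∈ F | v ∈ e} := by
    rw [Finset.prod_comm]
    simp [← Finset.prod_filter]
  simp only [this]
  rw [integral_fintype_prod_eq_prod (fun v y => halfSign y ^ #{e ∈ F | v ∈ e})]
  simp only [integral_halfSign_pow, IsEvenEdgeSet]
  rw [Finset.prod_ite_zero]
  simp only [mem_univ, true_imp_iff, Finset.prod_const_one]
  congr

theorem integrable_prod_halfSign (F : Finset (Sym2 V)) :
    Integrable (fun x : V → ℝ => ∏ e ∈ F, ∏ v, (if v ∈ e then halfSign (x v) else 1))
      (Measure.pi fun _ => unitM) := by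
  refine Integrable.of_bound (C := 1) (Measurable.aestronglyMeasurable ?_) (ae_of_all _ ?_)
  · refine Finset.measurable_fun_prod _ fun e _ => Finset.measurable_fun_prod _ fun v _ => ?_
    split_ifs
    · exact measurable_halfSign.comp (measurable_pi_apply v)
    · exact measurable_const
  · intro x
    rw [Real.norm_eq_abs, Finset.abs_prod]
    refine Finset.prod_le_one (fun _ _ => abs_nonneg _) fun e _ => ?_
    rw [Finset.abs_prod]
    refine Finset.prod_le_one (fun _ _ => abs_nonneg _) fun v _ => ?_
    split_ifs <;> simp [abs_halfSign]

theorem homDensity_twoBlock (G : SimpleGraph V) (p ε : ℝ) :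
    homDensity G (twoBlock p ε)
      = ∑ n ∈ range (#G.edgeFinset + 1),
          #(evenEdgeSets G n) * ε ^ n * p ^ (#G.edgeFinset - n) := by
  have (x : V → ℝ) : ∏ e ∈ G.edgeFinset, symEdge (twoBlock p ε) x e
      = ∑ F ∈ G.edgeFinset.powerset, ε ^ #F * p ^ (#G.edgeFinset - #F)
          * ∏ e ∈ F, ∏ v, (if v ∈ e then halfSign (x v) else 1) := by
    rw [Finset.prod_congr rfl fun e he =>
      symEdge_twoBlock p ε x (G.not_isDiag_of_mem_edgeFinset he), Finset.prod_add]
    refine Finset.sum_congr rfl fun F hF => ?_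
    rw [Finset.prod_mul_distrib, Finset.prod_const, Finset.prod_const,
      Finset.card_sdiff_of_subset (mem_powerset.1 hF)]
    ring
  simp only [homDensity, this]
  rw [integral_finsetSum _ fun F _ => (integrable_prod_halfSign F).const_mul _]
  simp only [integral_const_mul, integral_prod_halfSign]
  rw [Finset.sum_powerset]
  refine Finset.sum_congr rfl fun n _ => ?_
  have (F) (hF : F ∈ powersetCard n G.edgeFinset) :
      ε ^ #F * p ^ (#G.edgeFinset - #F) * (if IsEvenEdgeSet F then 1 else 0)
        = if IsEvenEdgeSet F then ε ^ n * p ^ (#G.edgeFinset - n) else 0 := by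
    rw [(mem_powersetCard.1 hF).2]; simp
  rw [Finset.sum_congr rfl this, ← Finset.sum_filter, Finset.sum_const, nsmul_eq_mul,
    evenEdgeSets, mul_assoc]

theorem eCount_eq_card_edgeFinset (G : SimpleGraph V) : eCount G = #G.edgeFinset := by
  rw [eCount, Set.ncard_eq_toFinset_card', SimpleGraph.edgeFinset]

/-- Local expansion of the normalised homomorphism density around the constant graphon `p`. -/
theorem exists_continuous_homDensity_twoBlock {G : SimpleGraph V} {k : ℕ} (hk : 3 ≤ k)
    (hg : (k : ℕ∞) ≤ G.egirth) {p : ℝ} (hp : 0 < p) :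
    ∃ Q : ℝ → ℝ, Continuous Q ∧ ∀ ε,
      homDensity G (twoBlock p ε) / (eCount G * p ^ (eCount G - 1))
        = p / eCount G + cycleCount k G / (eCount G * p ^ (k - 1)) * ε ^ k
          + ε ^ (k + 1) * Q ε := by
  obtain he | he := Nat.eq_zero_or_pos (eCount G)
  · exact ⟨fun _ => 0, continuous_const, fun ε => by simp [he]⟩
  let m := eCount G
  let a (n : ℕ) : ℝ := #(evenEdgeSets G n) * p / (m * p ^ n)
  have hm : (m : ℝ) ≠ 0 := by exact_mod_cast he.ne'
  refine ⟨fun ε => ∑ i ∈ range m, a (k + 1 + i) * ε ^ i, by fun_prop, fun ε => ?_⟩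
  have hext : homDensity G (twoBlock p ε) / (m * p ^ (m - 1))
      = ∑ n ∈ range (k + 1 + m), a n * ε ^ n := by
    rw [homDensity_twoBlock, ← eCount_eq_card_edgeFinset, Finset.sum_div,
      ← Finset.sum_subset (Finset.range_subset_range.2 (by omega : eCount G + 1 ≤ k + 1 + m))]
    · refine Finset.sum_congr rfl fun n hn => ?_
      have hn : n ≤ m := by simpa [Nat.lt_succ_iff] using hn
      have h1 : p ^ m = p ^ (m - n) * p ^ n := by rw [← pow_add]; congr 1; omega
      have h2 : p ^ m = p ^ (m - 1) * p := by rw [← pow_succ]; congr 1; omega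
      simp only [a]
      rw [div_mul_eq_mul_div, div_eq_div_iff (by positivity) (by positivity)]
      linear_combination (#(evenEdgeSets G n) * ε ^ n * m : ℝ) * (h2 - h1)
    · intro n _ hn
      have : #G.edgeFinset < n := by
        rw [← eCount_eq_card_edgeFinset]; simpa using hn
      simp [a, evenEdgeSets_eq_empty_of_card_lt this]
  have hlow : ∑ n ∈ range k, a n * ε ^ n = p / m := by
    rw [Finset.sum_eq_single 0]
    · simp [a, card_evenEdgeSets_zero]
    · intro n hn h0
      have : (n : ℕ∞) < G.egirth := lt_of_lt_of_le (by exact_mod_cast mem_range.1 hn) hg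
      simp [a, evenEdgeSets_eq_empty_of_lt_egirth h0 this]
    · simp; omega
  have hak : a k = cycleCount k G / (m * p ^ (k - 1)) := by
    have h2 : p ^ k = p ^ (k - 1) * p := by rw [← pow_succ]; congr 1; omega
    simp only [a, card_evenEdgeSets_eq_cycleCount hk hg, h2]
    field_simp
  change homDensity G (twoBlock p ε) / (m * p ^ (m - 1)) = p / m + _ / (m * _) * _ + _
  rw [hext, Finset.sum_range_add, Finset.sum_range_succ, hlow, hak, Finset.mul_sum]
  congr 1
  refine Finset.sum_congr rfl fun i _ => ?_
  rw [pow_add]; ring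

end RankOne

/-- If `a ε ^ k` with `k` odd is nonnegative near `0` up to a higher order term, then `a = 0`. -/
theorem eq_zero_of_odd_of_nonneg_near_zero {a δ : ℝ} {k : ℕ} (hk : Odd k) (hδ : 0 < δ)
    {Q : ℝ → ℝ} (hQ : Continuous Q)
    (h : ∀ ε, |ε| ≤ δ → 0 ≤ a * ε ^ k + ε ^ (k + 1) * Q ε) : a = 0 := by
  have hlim : Filter.Tendsto (fun ε => a + ε * Q ε) (nhds 0) (nhds a) := by
    have : Continuous fun ε => a + ε * Q ε := by fun_prop
    simpa using this.tendsto 0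
  have hnear : ∀ᶠ ε in nhds (0 : ℝ), |ε| ≤ δ := by
    filter_upwards [Metric.closedBall_mem_nhds (0 : ℝ) hδ] with ε hε
    simpa [Real.dist_eq] using hε
  refine le_antisymm ?_ ?_
  · refine le_of_tendsto (hlim.mono_left (nhdsWithin_le_nhds (s := Set.Iio 0))) ?_
    filter_upwards [nhdsWithin_le_nhds hnear, self_mem_nhdsWithin] with ε h1 h2
    have := h ε h1
    have hneg : ε ^ k < 0 := hk.pow_neg h2
    rw [show a * ε ^ k + ε ^ (k + 1) * Q ε = ε ^ k * (a + ε * Q ε) by ring] at this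
    exact nonpos_of_mul_nonneg_right this hneg
  · refine ge_of_tendsto (hlim.mono_left (nhdsWithin_le_nhds (s := Set.Ioi 0))) ?_
    filter_upwards [nhdsWithin_le_nhds hnear, self_mem_nhdsWithin] with ε h1 h2
    have := h ε h1
    have hpos : 0 < ε ^ k := pow_pos h2 k
    rw [show a * ε ^ k + ε ^ (k + 1) * Q ε = ε ^ k * (a + ε * Q ε) by ring] at this
    exact nonneg_of_mul_nonneg_right this hpos

open SimpleGraph in
theorem cycleCount_pos_iff {V : Type*} [Fintype V] {G : SimpleGraph V} {k : ℕ} (hk : 3 ≤ k) :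
    0 < cycleCount k G ↔ ∃ (v : V) (c : G.Walk v v), c.IsCycle ∧ c.length = k := by
  rw [← cycleGraph_isContained_iff hk, isContained_iff_exists_iso_subgraph, cycleCount,
    Nat.card_pos_iff]
  constructor
  · rintro ⟨⟨H, ⟨f⟩⟩, -⟩
    exact ⟨H, ⟨f.symm⟩⟩
  · rintro ⟨H, ⟨f⟩⟩
    exact ⟨⟨H, ⟨f.symm⟩⟩, inferInstance⟩

/-- If `g(H₂)` is odd and `(H₁,H₂)` is `(p₁,p₂)`-common, then either
`g(H₁) < g(H₂)`, or `g(H₁) = g(H₂) = k` and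
`c_k(H₁)/(e(H₁)p₁^{k-1}) = c_k(H₂)/(e(H₂)p₂^{k-1})`. -/
theorem girth_common_pair {V₁ V₂ : Type*} [Fintype V₁] [Fintype V₂]
    (G₁ : SimpleGraph V₁) (G₂ : SimpleGraph V₂)
    (p₁ p₂ : ℝ) (hp₁ : p₁ ∈ Set.Ioo (0:ℝ) 1) (hp₂ : p₂ ∈ Set.Ioo (0:ℝ) 1)
    (hsum : p₁ + p₂ = 1)
    (k₂ : ℕ) (hodd : Odd k₂) (hg₂ : G₂.egirth = (k₂ : ℕ∞))
    (hcommon : IsCommonPair G₁ G₂ p₁ p₂) :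
    G₁.egirth < G₂.egirth ∨
      ∃ k : ℕ, G₁.egirth = (k : ℕ∞) ∧ G₂.egirth = (k : ℕ∞) ∧
        (cycleCount k G₁ : ℝ) / (eCount G₁ * p₁ ^ (k - 1))
          = (cycleCount k G₂ : ℝ) / (eCount G₂ * p₂ ^ (k - 1)) := by
  rw [or_iff_not_imp_left, not_lt]
  intro hle
  have hk : 3 ≤ k₂ := by
    have := G₂.three_le_egirth
    rw [hg₂] at this
    exact_mod_cast this
  rw [hg₂] at hle
  obtain ⟨Q₁, hQ₁, h₁⟩ := exists_continuous_homDensity_twoBlock hk hle hp₁.1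
  obtain ⟨Q₂, hQ₂, h₂⟩ := exists_continuous_homDensity_twoBlock hk hg₂.ge hp₂.1
  have hcoeff := eq_zero_of_odd_of_nonneg_near_zero
    (a := cycleCount k₂ G₁ / (eCount G₁ * p₁ ^ (k₂ - 1))
      - cycleCount k₂ G₂ / (eCount G₂ * p₂ ^ (k₂ - 1)))
    (Q := fun ε => Q₁ ε + Q₂ (-ε)) hodd (lt_min hp₁.1 hp₂.1) (by fun_prop) fun ε hε => by
      obtain ⟨hε₁, hε₂⟩ := le_min_iff.1 hε
      have h := hcommon (twoBlock p₁ ε) (twoBlock p₂ (-ε))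
        (isGraphon_twoBlock hε₁ (by linarith))
        (isGraphon_twoBlock (by rwa [abs_neg]) (by rw [abs_neg]; linarith))
        (fun x y => by simp only [twoBlock]; linarith)
      rw [h₁, h₂, hodd.neg_pow, hodd.add_one.neg_pow] at h
      linarith
  rw [sub_eq_zero] at hcoeff
  have hne : ¬ G₂.IsAcyclic := by
    rw [← SimpleGraph.egirth_eq_top, hg₂]
    exact ENat.natCast_ne_top k₂
  obtain ⟨v, c, hc, hlen⟩ := SimpleGraph.exists_egirth_eq_length.2 hne
  have hpos₂ : 0 < cycleCount k₂ G₂ := by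
    refine (cycleCount_pos_iff hk).2 ⟨v, c, hc, ?_⟩
    rw [hg₂] at hlen
    exact_mod_cast hlen.symm
  have he₂ : 0 < eCount G₂ := by
    rw [eCount, Set.ncard_pos]
    exact ⟨_, c.edges_subset_edgeSet (c.mk_start_snd_mem_edges hc.not_nil)⟩
  have hpos₁ : 0 < cycleCount k₂ G₁ := by
    by_contra! h0
    have hp₂' := hp₂.1
    have : (0 : ℝ) < cycleCount k₂ G₂ / (eCount G₂ * p₂ ^ (k₂ - 1)) := by positivity
    rw [← hcoeff, Nat.le_zero.1 h0] at this
    simp at this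
  obtain ⟨u, d, hd, hdlen⟩ := (cycleCount_pos_iff hk).1 hpos₁
  refine ⟨k₂, le_antisymm ?_ hle, hg₂, hcoeff⟩
  rw [← hdlen]
  exact SimpleGraph.egirth_le_length hd
end

section
/- For odd k ≥ 3 and p ∈ (0,1), the pair (C_k, C_k) is (p, 1-p)-common if and only if p = 1/2. -/
open MeasureTheory Finset

theorem IsKernel.measurable_comp {W : ℝ → ℝ → ℝ} (hW : IsKernel W) {α : Type*}
    [MeasurableSpace α] {f g : α → ℝ} (hf : Measurable f) (hg : Measurable g) :
    Measurable fun a => W (f a) (g a) :=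
  hW.1.comp (hf.prodMk hg)

theorem IsKernel.add_const {W : ℝ → ℝ → ℝ} (hW : IsKernel W) (s : ℝ) :
    IsKernel fun x y => W x y + s := by
  obtain ⟨hm, hs, C, hC⟩ := hW
  refine ⟨hm.add_const s, fun x y => congrArg (· + s) (hs x y), C + |s|, fun x y => ?_⟩
  exact (abs_add_le _ _).trans (by gcongr; exact hC x y)

/-- The iterates on the constant function `1` of the integral operator with kernel `W`. -/
noncomputable def pathIter (μ : Measure ℝ) (W : ℝ → ℝ → ℝ) : ℕ → ℝ → ℝ
  | 0 => fun _ => 1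
  | j + 1 => fun x => ∫ y, W x y * pathIter μ W j y ∂μ

section

variable {μ : Measure ℝ} [IsProbabilityMeasure μ] {W : ℝ → ℝ → ℝ}

theorem measurable_pathIter (hW : IsKernel W) (j : ℕ) : Measurable (pathIter μ W j) := by
  induction j with
  | zero => exact measurable_const
  | succ j ih =>
    have h : StronglyMeasurable (Function.uncurry fun x y => W x y * pathIter μ W j y) :=
      (hW.1.mul (ih.comp measurable_snd)).stronglyMeasurable
    exact h.integral_prod_right.measurable

theorem exists_pathIter_bound (hW : IsKernel W) (j : ℕ) : ∃ D, ∀ x, |pathIter μ W j x| ≤ D := by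
  obtain ⟨C, hC⟩ := hW.2.2
  induction j with
  | zero => exact ⟨1, fun x => by simp [pathIter]⟩
  | succ j ih =>
    obtain ⟨D, hD⟩ := ih
    refine ⟨C * D, fun x => ?_⟩
    have := norm_integral_le_of_norm_le_const (μ := μ) (C := C * D)
      (f := fun y => W x y * pathIter μ W j y) (.of_forall fun y => by
        rw [norm_mul]
        exact mul_le_mul (hC x y) (hD y) (norm_nonneg _) ((abs_nonneg _).trans (hC x y)))
    simpa [pathIter] using this

theorem integrable_of_abs_le {α : Type*} [MeasurableSpace α] {ν : Measure α} [IsFiniteMeasure ν]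
    {f : α → ℝ} (hf : Measurable f) (hb : ∃ D, ∀ x, |f x| ≤ D) : Integrable f ν :=
  hb.elim fun D hD => .of_bound hf.aestronglyMeasurable D (.of_forall hD)

theorem exists_abs_mul_bound {α : Type*} {f g : α → ℝ} (hf : ∃ D, ∀ x, |f x| ≤ D)
    (hg : ∃ D, ∀ x, |g x| ≤ D) : ∃ D, ∀ x, |f x * g x| ≤ D := by
  obtain ⟨C, hC⟩ := hf
  obtain ⟨D, hD⟩ := hg
  refine ⟨C * D, fun x => ?_⟩
  rw [abs_mul]
  exact mul_le_mul (hC x) (hD x) (abs_nonneg _) ((abs_nonneg _).trans (hC x))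

theorem sq_integral_mul_le {α : Type*} [MeasurableSpace α] {ν : Measure α} [IsFiniteMeasure ν]
    {f g : α → ℝ} (hf : Measurable f) (hg : Measurable g) (hfb : ∃ D, ∀ x, |f x| ≤ D)
    (hgb : ∃ D, ∀ x, |g x| ≤ D) :
    (∫ x, f x * g x ∂ν) ^ 2 ≤ (∫ x, f x * f x ∂ν) * ∫ x, g x * g x ∂ν := by
  have hff : Integrable (fun x => f x * f x) ν :=
    integrable_of_abs_le (hf.mul hf) (exists_abs_mul_bound hfb hfb)
  have hfg : Integrable (fun x => f x * g x) ν :=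
    integrable_of_abs_le (hf.mul hg) (exists_abs_mul_bound hfb hgb)
  have hgg : Integrable (fun x => g x * g x) ν :=
    integrable_of_abs_le (hg.mul hg) (exists_abs_mul_bound hgb hgb)
  have key : ∀ t : ℝ, 0 ≤ (∫ x, f x * f x ∂ν) * (t * t) + (2 * ∫ x, f x * g x ∂ν) * t
      + ∫ x, g x * g x ∂ν := by
    intro t
    have h : 0 ≤ ∫ x, (t * f x + g x) * (t * f x + g x) ∂ν :=
      integral_nonneg fun x => mul_self_nonneg _
    have e : (fun x => (t * f x + g x) * (t * f x + g x))
        = fun x => (t * t) * (f x * f x) + (2 * t) * (f x * g x) + g x * g x := by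
      funext x; ring
    have h₁ := hff.const_mul (t * t)
    have h₂ := hfg.const_mul (2 * t)
    rw [e, integral_add (h₁.fun_add h₂) hgg, integral_add h₁ h₂, integral_const_mul,
      integral_const_mul] at h
    linarith
  have := discrim_le_zero key
  rw [discrim] at this
  linarith

theorem integral_pathIter_succ_mul (hW : IsKernel W) (i j : ℕ) :
    ∫ x, pathIter μ W (i + 1) x * pathIter μ W j x ∂μ
      = ∫ x, pathIter μ W i x * pathIter μ W (j + 1) x ∂μ := by
  have hi := measurable_pathIter (μ := μ) hW i
  have hj := measurable_pathIter (μ := μ) hW j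
  obtain ⟨C, hC⟩ := hW.2.2
  obtain ⟨Di, hDi⟩ := exists_pathIter_bound (μ := μ) hW i
  obtain ⟨Dj, hDj⟩ := exists_pathIter_bound (μ := μ) hW j
  have hint : Integrable (Function.uncurry fun x y =>
      W x y * pathIter μ W i y * pathIter μ W j x) (μ.prod μ) := by
    refine integrable_of_abs_le
      ((hW.1.mul (hi.comp measurable_snd)).mul (hj.comp measurable_fst)) ?_
    exact exists_abs_mul_bound (exists_abs_mul_bound ⟨C, fun z => hC z.1 z.2⟩
      ⟨Di, fun z => hDi z.2⟩) ⟨Dj, fun z => hDj z.1⟩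
  calc ∫ x, pathIter μ W (i + 1) x * pathIter μ W j x ∂μ
      = ∫ x, ∫ y, W x y * pathIter μ W i y * pathIter μ W j x ∂μ ∂μ := by
        simp only [pathIter, integral_mul_const]
    _ = ∫ y, ∫ x, W x y * pathIter μ W i y * pathIter μ W j x ∂μ ∂μ := integral_integral_swap hint
    _ = ∫ x, pathIter μ W i x * pathIter μ W (j + 1) x ∂μ := by
        refine integral_congr_ae (.of_forall fun y => ?_)
        simp only [pathIter, ← integral_const_mul]
        refine integral_congr_ae (.of_forall fun x => ?_)
        simp only [hW.2.1 x y]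
        ring

theorem integral_pathIter_add (hW : IsKernel W) (i j : ℕ) :
    ∫ x, pathIter μ W i x * pathIter μ W j x ∂μ = ∫ x, pathIter μ W (i + j) x ∂μ := by
  induction j generalizing i with
  | zero => simp [pathIter]
  | succ j ih => rw [← integral_pathIter_succ_mul hW, ih, add_right_comm, add_assoc]

/-- Even paths satisfy the Sidorenko inequality for arbitrary kernels. -/
theorem pow_le_integral_pathIter_two_mul (hW : IsKernel W) (m : ℕ) :
    (∫ x, pathIter μ W 1 x ∂μ) ^ (2 * m) ≤ ∫ x, pathIter μ W (2 * m) x ∂μ := by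
  set b : ℕ → ℝ := fun m => ∫ x, pathIter μ W (2 * m) x ∂μ with hb
  have hsq (m : ℕ) : b m = ∫ x, pathIter μ W m x * pathIter μ W m x ∂μ := by
    rw [integral_pathIter_add hW, ← two_mul]
  have hb0 : b 0 = 1 := by simp [hb, pathIter]
  have hnn (m : ℕ) : 0 ≤ b m := by
    rw [hsq]; exact integral_nonneg fun x => mul_self_nonneg _
  have hlog (m : ℕ) : b (m + 1) ^ 2 ≤ b m * b (m + 2) := by
    have := sq_integral_mul_le (ν := μ) (measurable_pathIter (μ := μ) hW m)
      (measurable_pathIter (μ := μ) hW (m + 2)) (exists_pathIter_bound hW m)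
      (exists_pathIter_bound hW (m + 2))
    rw [← hsq, ← hsq, integral_pathIter_add hW] at this
    rwa [show m + (m + 2) = 2 * (m + 1) by ring] at this
  have hone : (∫ x, pathIter μ W 1 x ∂μ) ^ 2 ≤ b 1 := by
    have := sq_integral_mul_le (ν := μ) (measurable_pathIter (μ := μ) hW 0)
      (measurable_pathIter (μ := μ) hW 1) (exists_pathIter_bound hW 0)
      (exists_pathIter_bound hW 1)
    rw [← hsq, ← hsq, integral_pathIter_add hW, hb0, one_mul, zero_add] at this
    exact this
  have hratio (m : ℕ) : b 1 * b m ≤ b (m + 1) := by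
    induction m with
    | zero => simp [hb0]
    | succ m ih =>
      rcases (hnn (m + 1)).eq_or_lt with h0 | hpos
      · rw [← h0, mul_zero]; exact hnn _
      · have hbm : 0 < b m := by
          refine (hnn m).lt_of_ne fun h => ?_
          have := hlog m
          rw [← h, zero_mul] at this
          nlinarith
        refine le_of_mul_le_mul_left ?_ hbm
        nlinarith [hlog m, mul_le_mul_of_nonneg_right ih hpos.le]
  have hpow : b 1 ^ m ≤ b m := by
    induction m with
    | zero => simp [hb0]
    | succ m ih =>
      rw [pow_succ']
      exact (mul_le_mul_of_nonneg_left ih (hnn 1)).trans (hratio m)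
  calc (∫ x, pathIter μ W 1 x ∂μ) ^ (2 * m) = ((∫ x, pathIter μ W 1 x ∂μ) ^ 2) ^ m := pow_mul _ _ _
    _ ≤ b 1 ^ m := pow_le_pow_left₀ (sq_nonneg _) hone m
    _ ≤ b m := hpow

end

section

variable {μ : Measure ℝ} [IsProbabilityMeasure μ] {W : ℝ → ℝ → ℝ}

theorem exists_abs_prod_bound {ι α : Type*} (s : Finset ι) {f : ι → α → ℝ}
    (h : ∀ i, ∃ D, ∀ x, |f i x| ≤ D) : ∃ D, ∀ x, |∏ i ∈ s, f i x| ≤ D := by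
  choose D hD using h
  refine ⟨∏ i ∈ s, D i, fun x => ?_⟩
  rw [abs_prod]
  exact prod_le_prod (fun _ _ => abs_nonneg _) fun i _ => hD i x

/-- Integration over the vertices of a path following a fixed initial vertex. -/
theorem integral_prod_cons (hW : IsKernel W) (n : ℕ) (x₀ : ℝ) :
    ∫ y : Fin n → ℝ, ∏ i : Fin n, W ((Fin.cons x₀ y : Fin (n + 1) → ℝ) i.castSucc) (y i)
      ∂(Measure.pi fun _ => μ) = pathIter μ W n x₀ := by
  induction n generalizing x₀ with
  | zero => simp [pathIter]
  | succ n ih =>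
    have hmp := (measurePreserving_piFinSuccAbove (fun _ : Fin (n + 1) => μ) 0).symm
    rw [← hmp.integral_comp (MeasurableEquiv.measurableEmbedding _), integral_prod]
    · rw [pathIter]
      refine integral_congr_ae (.of_forall fun y₀ => ?_)
      simp only [← ih, ← integral_const_mul]
      refine integral_congr_ae (.of_forall fun y => ?_)
      simp [Fin.prod_univ_succ, MeasurableEquiv.piFinSuccAbove, Fin.insertNthEquiv]
    · refine integrable_of_abs_le ?_ (exists_abs_prod_bound _ fun i => ?_)
      · refine Finset.measurable_prod _ fun i _ => hW.measurable_comp ?_ ?_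
        · refine Fin.cases ?_ (fun j => ?_) i
          · simp
          · simp only [← Fin.succ_castSucc, Fin.cons_succ]
            exact (measurable_pi_apply _).comp (MeasurableEquiv.measurable _)
        · exact (measurable_pi_apply _).comp (MeasurableEquiv.measurable _)
      · exact hW.2.2.imp fun C hC z => hC _ _

theorem integral_path (hW : IsKernel W) (n : ℕ) :
    ∫ x : Fin (n + 1) → ℝ, ∏ i : Fin n, W (x i.castSucc) (x i.succ) ∂(Measure.pi fun _ => μ)
      = ∫ x, pathIter μ W n x ∂μ := by
  have hmp := (measurePreserving_piFinSuccAbove (fun _ : Fin (n + 1) => μ) 0).symm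
  rw [← hmp.integral_comp (MeasurableEquiv.measurableEmbedding _), integral_prod]
  · refine integral_congr_ae (.of_forall fun y₀ => ?_)
    simp only [← integral_prod_cons hW]
    refine integral_congr_ae (.of_forall fun y => ?_)
    simp [MeasurableEquiv.piFinSuccAbove, Fin.insertNthEquiv]
  · refine integrable_of_abs_le ?_ (exists_abs_prod_bound _ fun i => ?_)
    · exact Finset.measurable_prod _ fun i _ => hW.measurable_comp
        ((measurable_pi_apply _).comp (MeasurableEquiv.measurable _))
        ((measurable_pi_apply _).comp (MeasurableEquiv.measurable _))
    · exact hW.2.2.imp fun C hC z => hC _ _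

theorem integral_cycle_erase (hW : IsKernel W) (n : ℕ) (i : Fin (n + 1)) :
    ∫ x : Fin (n + 1) → ℝ, ∏ j ∈ univ.erase i, W (x j) (x (j + 1)) ∂(Measure.pi fun _ => μ)
      = ∫ x, pathIter μ W n x ∂μ := by
  have hmp := measurePreserving_piCongrLeft (fun _ : Fin (n + 1) => μ)
    (Equiv.addRight (i - Fin.last n))
  rw [← integral_path hW, ← hmp.integral_comp (MeasurableEquiv.measurableEmbedding _)]
  refine integral_congr_ae (.of_forall fun x => ?_)
  have happ (j : Fin (n + 1)) : MeasurableEquiv.piCongrLeft (fun _ : Fin (n + 1) => ℝ)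
      (Equiv.addRight (i - Fin.last n)) x (j + (i - Fin.last n)) = x j :=
    MeasurableEquiv.piCongrLeft_apply_apply (β := fun _ => ℝ) (Equiv.addRight (i - Fin.last n)) x j
  refine (prod_bij (fun (j : Fin n) _ => j.castSucc + (i - Fin.last n)) ?_ ?_ ?_ ?_).symm
  · intro j _
    simp only [mem_erase, mem_univ, and_true]
    intro h
    have : j.castSucc = Fin.last n := by
      have h' : j.castSucc + (i - Fin.last n) = Fin.last n + (i - Fin.last n) := by
        rw [h]; abel
      exact add_right_cancel h'
    exact (Fin.castSucc_lt_last j).ne this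
  · intro a _ b _ h
    exact Fin.castSucc_injective _ (add_right_cancel h)
  · intro b hb
    have hne : b - (i - Fin.last n) ≠ Fin.last n := by
      intro h
      refine (mem_erase.1 hb).1 ?_
      rw [sub_eq_iff_eq_add.1 h]; abel
    exact ⟨(b - (i - Fin.last n)).castPred hne, mem_univ _, by simp⟩
  · intro j _
    have e : j.castSucc + (i - Fin.last n) + 1 = j.succ + (i - Fin.last n) := by
      rw [← Fin.coeSucc_eq_succ]; abel
    rw [e, happ, happ]

theorem hasDerivAt_cycle (hW : IsKernel W) (n : ℕ) (s : ℝ) :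
    HasDerivAt (fun s => ∫ x : Fin (n + 1) → ℝ, ∏ i, (W (x i) (x (i + 1)) + s)
      ∂(Measure.pi fun _ => μ))
      ((n + 1) * ∫ x, pathIter μ (fun x y => W x y + s) n x ∂μ) s := by
  obtain ⟨C, hC⟩ := hW.2.2
  have hmeas (s : ℝ) (u : Finset (Fin (n + 1))) :
      Measurable fun x : Fin (n + 1) → ℝ => ∏ i ∈ u, (W (x i) (x (i + 1)) + s) :=
    Finset.measurable_prod _ fun i _ => (hW.add_const s).measurable_comp
      (measurable_pi_apply _) (measurable_pi_apply _)
  have hint (s : ℝ) (u : Finset (Fin (n + 1))) :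
      Integrable (fun x : Fin (n + 1) → ℝ => ∏ i ∈ u, (W (x i) (x (i + 1)) + s))
        (Measure.pi fun _ => μ) :=
    integrable_of_abs_le (hmeas s u) (exists_abs_prod_bound _ fun i =>
      (hW.add_const s).2.2.imp fun C hC x => hC _ _)
  have h := (hasDerivAt_integral_of_dominated_loc_of_deriv_le
    (μ := Measure.pi fun _ : Fin (n + 1) => μ) (x₀ := s) (s := Metric.ball s 1)
    (F := fun s x => ∏ i, (W (x i) (x (i + 1)) + s))
    (F' := fun s x => ∑ i, ∏ j ∈ univ.erase i, (W (x j) (x (j + 1)) + s))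
    (bound := fun _ => ∑ i : Fin (n + 1), ∏ j ∈ univ.erase i, (C + (|s| + 1)))
    (Metric.ball_mem_nhds s one_pos)
    (.of_forall fun t => (hmeas t univ).aestronglyMeasurable) (hint s univ)
    (Finset.measurable_sum _ fun i _ => hmeas s _).aestronglyMeasurable
    (.of_forall fun x t ht => ?_) (integrable_const _) (.of_forall fun x t _ => ?_)).2
  · rw [integral_finsetSum _ fun i _ => hint s _] at h
    simpa [integral_cycle_erase (hW.add_const s)] using h
  · refine (norm_sum_le _ _).trans (sum_le_sum fun i _ => ?_)
    rw [Real.norm_eq_abs, abs_prod]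
    refine prod_le_prod (fun _ _ => abs_nonneg _) fun j _ => (abs_add_le _ _).trans ?_
    have ht' : |t| ≤ |s| + 1 := by
      rw [Metric.mem_ball, Real.dist_eq] at ht
      have := abs_sub_abs_le_abs_sub t s
      linarith
    gcongr
    exact hC _ _
  · have := HasDerivAt.fun_finsetProd (u := univ)
      (f := fun (i : Fin (n + 1)) t => W (x i) (x (i + 1)) + t) (f' := fun _ => 1) (x := t)
      fun i _ => (hasDerivAt_id t).const_add _
    simpa using this

end

theorem one_add_one_fin_ne_zero {n : ℕ} (hn : 2 ≤ n) : (1 : Fin (n + 1)) + 1 ≠ 0 := by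
  obtain ⟨m, rfl⟩ := Nat.exists_eq_add_of_le' hn
  intro h
  have := congrArg Fin.val h
  simp only [Fin.val_add, Fin.val_one, Fin.val_zero] at this
  rw [Nat.mod_eq_of_lt (by lia)] at this
  lia

theorem injective_cycleEdge {n : ℕ} (hn : 2 ≤ n) :
    Function.Injective fun i : Fin (n + 1) => s(i, i + 1) := by
  intro a b h
  rcases Sym2.eq_iff.1 h with h | h
  · exact h.1
  · refine absurd ?_ (one_add_one_fin_ne_zero hn)
    have h' : b + 1 + 1 = b := by rw [← h.1, h.2]
    rwa [add_assoc, add_eq_left] at h'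

theorem cycleGraph_edgeSet {n : ℕ} (hn : 1 ≤ n) :
    (SimpleGraph.cycleGraph (n + 1)).edgeSet = Set.range fun i : Fin (n + 1) => s(i, i + 1) := by
  obtain ⟨m, rfl⟩ := Nat.exists_eq_add_of_le' hn
  ext e
  induction e with
  | _ u v =>
    rw [SimpleGraph.mem_edgeSet, SimpleGraph.cycleGraph_adj, Set.mem_range]
    constructor
    · rintro (h | h)
      · exact ⟨v, by rw [sub_eq_iff_eq_add'.1 h, Sym2.eq_swap]⟩
      · exact ⟨u, by rw [sub_eq_iff_eq_add'.1 h]⟩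
    · rintro ⟨i, h⟩
      rcases Sym2.eq_iff.1 h with ⟨rfl, rfl⟩ | ⟨rfl, rfl⟩
      · right; abel
      · left; abel

theorem eCount_cycleGraph {n : ℕ} (hn : 2 ≤ n) :
    eCount (SimpleGraph.cycleGraph (n + 1)) = n + 1 := by
  rw [eCount, cycleGraph_edgeSet (by lia), ← Set.image_univ,
    Set.ncard_image_of_injective _ (injective_cycleEdge hn), Set.ncard_univ, Nat.card_fin]

theorem prod_cycleGraph_edgeFinset {n : ℕ} (hn : 2 ≤ n)
    [Fintype (SimpleGraph.cycleGraph (n + 1)).edgeSet] (f : Sym2 (Fin (n + 1)) → ℝ) :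
    ∏ e ∈ (SimpleGraph.cycleGraph (n + 1)).edgeFinset, f e = ∏ i : Fin (n + 1), f s(i, i + 1) := by
  refine (prod_bij (fun i _ => s(i, i + 1)) (fun i _ => ?_)
    (fun a _ b _ h => injective_cycleEdge hn h) (fun e he => ?_) fun i _ => rfl).symm
  · rw [SimpleGraph.mem_edgeFinset, cycleGraph_edgeSet (by lia)]
    exact ⟨i, rfl⟩
  · rw [SimpleGraph.mem_edgeFinset, cycleGraph_edgeSet (by lia)] at he
    obtain ⟨i, rfl⟩ := he
    exact ⟨i, mem_univ _, rfl⟩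

theorem homDensity_cycleGraph {n : ℕ} (hn : 2 ≤ n) {W : ℝ → ℝ → ℝ} (hW : IsSymm2 W) :
    homDensity (SimpleGraph.cycleGraph (n + 1)) W
      = ∫ x : Fin (n + 1) → ℝ, ∏ i, W (x i) (x (i + 1)) ∂(Measure.pi fun _ => unitM) := by
  refine integral_congr_ae (.of_forall fun x => ?_)
  refine (@prod_cycleGraph_edgeFinset n hn (_) (symEdge W x)).trans (prod_congr rfl fun i _ => ?_)
  simp only [symEdge, Sym2.lift_mk]
  rw [hW (x (i + 1)) (x i)]
  ring

theorem IsGraphon.isKernel {W : ℝ → ℝ → ℝ} (hW : IsGraphon W) : IsKernel W :=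
  ⟨hW.1, hW.2.1, 1, fun x y => abs_le.2 ⟨by linarith [(hW.2.2 x y).1], (hW.2.2 x y).2⟩⟩

theorem two_mul_half_pow_le {k : ℕ} (hk : Odd k) {b : ℝ} (hb : |b| ≤ 1 / 2) :
    2 * (1 / 2) ^ k ≤ (b + 1 / 2) ^ k - (b - 1 / 2) ^ k := by
  obtain ⟨h₁, h₂⟩ := abs_le.1 hb
  have h := add_pow_le (a := b + 1 / 2) (b := 1 / 2 - b) (by linarith) (by linarith) k
  rw [show b + 1 / 2 + (1 / 2 - b) = 1 by ring, one_pow] at h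
  rw [← neg_sub (1 / 2) b, hk.neg_pow, sub_neg_eq_add]
  obtain ⟨m, rfl⟩ := hk
  rw [Nat.add_sub_cancel] at h
  calc 2 * (1 / 2 : ℝ) ^ (2 * m + 1)
      = (1 / 2) ^ (2 * m) * 1 := by ring
    _ ≤ (1 / 2) ^ (2 * m) * (2 ^ (2 * m) * ((b + 1 / 2) ^ (2 * m + 1)
        + (1 / 2 - b) ^ (2 * m + 1))) := by gcongr
    _ = _ := by rw [← mul_assoc, ← mul_pow]; norm_num

/-- Lower bound for the growth of the density of an odd cycle under constant shifts. -/
theorem pow_sub_pow_le_cycle_shift {μ : Measure ℝ} [IsProbabilityMeasure μ] {W : ℝ → ℝ → ℝ}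
    (hW : IsKernel W) (m : ℕ) {s t : ℝ} (hst : s ≤ t) :
    (∫ x, pathIter μ W 1 x ∂μ + t) ^ (2 * m + 1) - (∫ x, pathIter μ W 1 x ∂μ + s) ^ (2 * m + 1)
      ≤ ∫ x : Fin (2 * m + 1) → ℝ, ∏ i, (W (x i) (x (i + 1)) + t) ∂(Measure.pi fun _ => μ)
        - ∫ x : Fin (2 * m + 1) → ℝ, ∏ i, (W (x i) (x (i + 1)) + s)
          ∂(Measure.pi fun _ => μ) := by
  set b := ∫ x, pathIter μ W 1 x ∂μ with hb
  have hshift (s : ℝ) : ∫ x, pathIter μ (fun x y => W x y + s) 1 x ∂μ = b + s := by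
    have hm := measurable_pathIter (μ := μ) hW 1
    have hint := integrable_of_abs_le (ν := μ) hm (exists_pathIter_bound hW 1)
    have e : pathIter μ (fun x y => W x y + s) 1 = fun x => pathIter μ W 1 x + s := by
      funext x
      have hx : Integrable (fun y => W x y) μ := integrable_of_abs_le
        (hW.measurable_comp measurable_const measurable_id) (hW.2.2.imp fun C hC y => hC x y)
      simp [pathIter, integral_add hx (integrable_const s)]
    rw [e, integral_add hint (integrable_const s)]
    simp [hb]
  set F := fun s => ∫ x : Fin (2 * m + 1) → ℝ, ∏ i, (W (x i) (x (i + 1)) + s)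
    ∂(Measure.pi fun _ => μ)
  have hder (s : ℝ) : HasDerivAt (fun s => F s - (b + s) ^ (2 * m + 1))
      (((2 * m : ℕ) + 1) * ∫ x, pathIter μ (fun x y => W x y + s) (2 * m) x ∂μ
        - ((2 * m : ℕ) + 1) * (b + s) ^ (2 * m)) s := by
    have h := ((hasDerivAt_id s).const_add b).pow (2 * m + 1)
    simp only [id_eq, Nat.add_sub_cancel, mul_one] at h
    have h' := (hasDerivAt_cycle (μ := μ) hW (2 * m) s).sub h
    rwa [Nat.cast_succ (2 * m)] at h'
  have hmono : Monotone fun s => F s - (b + s) ^ (2 * m + 1) := by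
    refine monotone_of_deriv_nonneg (fun s => (hder s).differentiableAt) fun s => ?_
    rw [(hder s).deriv, ← mul_sub]
    have := pow_le_integral_pathIter_two_mul (μ := μ) (hW.add_const s) m
    rw [hshift] at this
    exact mul_nonneg (by positivity) (sub_nonneg.2 this)
  have := hmono hst
  simp only at this
  linarith

theorem two_mul_half_pow_le_cycle_add_cycle_compl {m : ℕ} (hm : 1 ≤ m) {W₁ W₂ : ℝ → ℝ → ℝ}
    (h₁ : IsGraphon W₁) (h₂ : IsGraphon W₂) (hW : ∀ x y, W₁ x y + W₂ x y = 1) :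
    2 * (1 / 2) ^ (2 * m + 1) ≤ homDensity (SimpleGraph.cycleGraph (2 * m + 1)) W₁
      + homDensity (SimpleGraph.cycleGraph (2 * m + 1)) W₂ := by
  rw [homDensity_cycleGraph (by lia) h₁.2.1, homDensity_cycleGraph (by lia) h₂.2.1]
  have hU := h₁.isKernel.add_const (-(1 / 2))
  have hb : |∫ x, pathIter unitM (fun x y => W₁ x y + -(1 / 2)) 1 x ∂unitM| ≤ 1 / 2 := by
    have hone (x : ℝ) : ‖pathIter unitM (fun x y => W₁ x y + -(1 / 2)) 1 x‖ ≤ 1 / 2 := by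
      have := norm_integral_le_of_norm_le_const (μ := unitM) (C := 1 / 2)
        (f := fun y => (W₁ x y + -(1 / 2)) * 1) (.of_forall fun y => by
          rw [Real.norm_eq_abs, abs_le]
          constructor <;> linarith [(h₁.2.2 x y).1, (h₁.2.2 x y).2])
      simpa [pathIter] using this
    simpa using norm_integral_le_of_norm_le_const (μ := unitM) (.of_forall hone)
  have key := pow_sub_pow_le_cycle_shift (μ := unitM) hU m
    (show (-(1 / 2) : ℝ) ≤ 1 / 2 by norm_num)
  have hpow := two_mul_half_pow_le (odd_two_mul_add_one m) hb
  have e₂ : ∀ x : Fin (2 * m + 1) → ℝ, ∏ i, W₂ (x i) (x (i + 1))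
      = -∏ i, (W₁ (x i) (x (i + 1)) + -(1 / 2) + -(1 / 2)) := fun x => by
    have : ∀ i, W₂ (x i) (x (i + 1)) = -(W₁ (x i) (x (i + 1)) + -(1 / 2) + -(1 / 2)) :=
      fun i => by linarith [hW (x i) (x (i + 1))]
    simp only [this]
    rw [prod_neg]
    simp [(odd_two_mul_add_one m).neg_one_pow]
  simp only [e₂, integral_neg]
  simp only [neg_add_cancel_right] at key
  rw [← sub_eq_add_neg _ (1 / 2 : ℝ)] at key
  linarith

/-- The balanced sign function on the unit interval. -/
noncomputable def balancedSign (x : ℝ) : ℝ := if x < 1 / 2 then 1 else -1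

theorem measurable_balancedSign : Measurable balancedSign :=
  Measurable.ite measurableSet_Iio measurable_const measurable_const

theorem balancedSign_mul_self (x : ℝ) : balancedSign x * balancedSign x = 1 := by
  unfold balancedSign; split_ifs <;> norm_num

theorem abs_balancedSign (x : ℝ) : |balancedSign x| = 1 := by
  unfold balancedSign; split_ifs <;> norm_num

theorem integral_balancedSign : ∫ x, balancedSign x ∂unitM = 0 := by
  have e : balancedSign = fun x => 2 * (Set.Iio (1 / 2)).indicator 1 x - 1 := by
    funext x
    by_cases h : x < 1 / 2
    · rw [balancedSign, if_pos h, Set.indicator_of_mem (Set.mem_Iio.2 h)]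
      norm_num
    · rw [balancedSign, if_neg h, Set.indicator_of_notMem (by simpa using h)]
      norm_num
  have hvol : unitM.real (Set.Iio (1 / 2)) = 1 / 2 := by
    rw [Measure.real, unitM, Measure.restrict_apply measurableSet_Iio,
      show Set.Iio (1 / 2 : ℝ) ∩ Set.Icc 0 1 = Set.Ico 0 (1 / 2) by
        ext x; simp only [Set.mem_inter_iff, Set.mem_Iio, Set.mem_Icc, Set.mem_Ico]
        constructor
        · rintro ⟨h, h', _⟩; exact ⟨h', h⟩
        · rintro ⟨h', h⟩; exact ⟨h, h', by linarith⟩]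
    simp
  rw [e, integral_sub, integral_const_mul, integral_indicator_one measurableSet_Iio, hvol]
  · simp
  · exact ((integrable_const _).indicator measurableSet_Iio).const_mul _
  · exact integrable_const _

theorem isKernel_balanced (δ : ℝ) : IsKernel fun x y => δ * (balancedSign x * balancedSign y) := by
  refine ⟨((measurable_balancedSign.comp measurable_fst).mul
    (measurable_balancedSign.comp measurable_snd)).const_mul δ, fun x y => by ring_nf, |δ|,
    fun x y => ?_⟩
  simp [abs_mul, abs_balancedSign]

theorem pathIter_balanced_add (δ s : ℝ) (n : ℕ) :
    pathIter unitM (fun x y => δ * (balancedSign x * balancedSign y) + s) n = fun _ => s ^ n := by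
  induction n with
  | zero => simp [pathIter]
  | succ n ih =>
    funext x
    have hint : Integrable balancedSign unitM :=
      integrable_of_abs_le measurable_balancedSign ⟨1, fun x => (abs_balancedSign x).le⟩
    simp only [pathIter, ih, integral_mul_const]
    simp only [← mul_assoc]
    rw [integral_add (hint.const_mul _) (integrable_const _), integral_const_mul,
      integral_balancedSign]
    simp [pow_succ']

theorem homDensity_cycle_balanced_add {n : ℕ} (hn : 2 ≤ n) (δ p : ℝ) :
    homDensity (SimpleGraph.cycleGraph (n + 1))
      (fun x y => δ * (balancedSign x * balancedSign y) + p) = δ ^ (n + 1) + p ^ (n + 1) := by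
  rw [homDensity_cycleGraph hn ((isKernel_balanced δ).add_const p).2.1]
  have hder (s : ℝ) : HasDerivAt (fun s => ∫ x : Fin (n + 1) → ℝ,
      ∏ i, (δ * (balancedSign (x i) * balancedSign (x (i + 1))) + s)
        ∂(Measure.pi fun _ => unitM) - s ^ (n + 1)) 0 s := by
    have h := (hasDerivAt_cycle (μ := unitM) (isKernel_balanced δ) n s).sub
      (hasDerivAt_pow (n + 1) s)
    simpa [pathIter_balanced_add, Pi.sub_def] using h
  have hconst := is_const_of_deriv_eq_zero (fun s => (hder s).differentiableAt)
    (fun s => (hder s).deriv) p 0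
  have hzero (x : Fin (n + 1) → ℝ) :
      ∏ i, (δ * (balancedSign (x i) * balancedSign (x (i + 1))) + 0) = δ ^ (n + 1) := by
    have hrot : ∏ i, balancedSign (x (i + 1)) = ∏ i, balancedSign (x i) :=
      Equiv.prod_comp (Equiv.addRight (1 : Fin (n + 1))) fun i => balancedSign (x i)
    simp only [add_zero]
    rw [prod_mul_distrib, prod_mul_distrib, hrot, ← prod_mul_distrib]
    simp [balancedSign_mul_self]
  simp only [hzero] at hconst
  simp at hconst
  linarith

theorem isGraphon_balanced_add {δ p : ℝ} (h₀ : |δ| ≤ p) (h₁ : |δ| ≤ 1 - p) :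
    IsGraphon fun x y => δ * (balancedSign x * balancedSign y) + p := by
  have hk := (isKernel_balanced δ).add_const p
  refine ⟨hk.1, hk.2.1, fun x y => ?_⟩
  have : |δ * (balancedSign x * balancedSign y)| = |δ| := by simp [abs_mul, abs_balancedSign]
  obtain ⟨h₂, h₃⟩ := abs_le.1 this.le
  constructor <;> linarith

theorem isCommonPair_oddCycle_half {m : ℕ} (hm : 1 ≤ m) :
    IsCommonPair (SimpleGraph.cycleGraph (2 * m + 1)) (SimpleGraph.cycleGraph (2 * m + 1))
      (1 / 2) (1 - 1 / 2) := by
  intro W₁ W₂ h₁ h₂ hW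
  have key := two_mul_half_pow_le_cycle_add_cycle_compl hm h₁ h₂ hW
  rw [eCount_cycleGraph (by lia), Nat.add_sub_cancel, show (1 - 1 / 2 : ℝ) = 1 / 2 by norm_num,
    ← add_div, ← add_div, ge_iff_le, div_le_div_iff₀ (by positivity) (by positivity)]
  rw [pow_succ] at key
  have : (0 : ℝ) ≤ ((2 * m + 1 : ℕ) : ℝ) := by positivity
  nlinarith

theorem not_isCommonPair_oddCycle {m : ℕ} (hm : 1 ≤ m) {p δ : ℝ} (h₀ : 0 < p) (h₁ : p < 1)
    (hδ₀ : |δ| ≤ p) (hδ₁ : |δ| ≤ 1 - p)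
    (hneg : δ ^ (2 * m + 1) / p ^ (2 * m) < δ ^ (2 * m + 1) / (1 - p) ^ (2 * m)) :
    ¬ IsCommonPair (SimpleGraph.cycleGraph (2 * m + 1)) (SimpleGraph.cycleGraph (2 * m + 1))
      p (1 - p) := by
  intro h
  have h' := h (fun x y => δ * (balancedSign x * balancedSign y) + p)
    (fun x y => -δ * (balancedSign x * balancedSign y) + (1 - p))
    (isGraphon_balanced_add hδ₀ hδ₁)
    (isGraphon_balanced_add (by rwa [abs_neg]) (by rw [abs_neg]; linarith))
    (fun x y => by ring)
  rw [homDensity_cycle_balanced_add (by lia), homDensity_cycle_balanced_add (by lia),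
    eCount_cycleGraph (by lia), Nat.add_sub_cancel, (odd_two_mul_add_one m).neg_pow,
    ← div_div, ← div_div, div_right_comm, div_right_comm (_ + _) _ ((1 - p) ^ _), ← add_div,
    ← add_div, ge_iff_le, div_le_div_iff_of_pos_right (by positivity)] at h'
  have hq : 0 < 1 - p := by linarith
  rw [add_div, add_div, pow_succ p, pow_succ (1 - p), mul_div_cancel_left₀ _ (by positivity),
    mul_div_cancel_left₀ _ (by positivity), neg_div] at h'
  linarith

/-- For odd `k ≥ 3` and `p ∈ (0,1)`, the pair `(C_k, C_k)` is `(p, 1-p)`-common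
if and only if `p = 1/2`. -/
theorem oddCycle_pair_common_iff (k : ℕ) (hk : 3 ≤ k) (hodd : Odd k)
    (p : ℝ) (hp : p ∈ Set.Ioo (0:ℝ) 1) :
    IsCommonPair (SimpleGraph.cycleGraph k) (SimpleGraph.cycleGraph k) p (1 - p)
      ↔ p = 1/2 := by
  obtain ⟨m, rfl⟩ := hodd
  have hm : 1 ≤ m := by lia
  obtain ⟨h₀, h₁⟩ := hp
  constructor
  · contrapose!
    intro hne
    rcases hne.lt_or_gt with hlt | hgt
    · refine not_isCommonPair_oddCycle hm (δ := -p) h₀ h₁ ?_ ?_ ?_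
      · rw [abs_neg, abs_of_pos h₀]
      · rw [abs_neg, abs_of_pos h₀]; linarith
      · rw [(odd_two_mul_add_one m).neg_pow, neg_div, neg_div, neg_lt_neg_iff]
        have : p < 1 - p := by linarith
        gcongr
    · have hq : 0 < 1 - p := by linarith
      refine not_isCommonPair_oddCycle hm (δ := 1 - p) h₀ h₁ ?_ ?_ ?_
      · rw [abs_of_pos hq]; linarith
      · rw [abs_of_pos hq]
      · have : 1 - p < p := by linarith
        gcongr
  · rintro rfl
    exact isCommonPair_oddCycle_half hm
end

section
/- Let H₁, H₂ be graphs and p₁, p₂ ∈ (0,1) with p₁+p₂=1. If (H₁,H₂) is (p₁,p₂)-common, then both H₁ and H₂ are K₄-free. -/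
open MeasureTheory Finset

/-- The kernel with value `1` on the diagonal and `-1` off it on the points `1, 2, 3, 4`,
and vanishing as soon as one of the arguments is `0`. -/
def blockSign (a b : Fin 5) : ℤ := if a = 0 ∨ b = 0 then 0 else if a = b then 1 else -1

theorem blockSign_comm (a b : Fin 5) : blockSign a b = blockSign b a := by
  unfold blockSign
  simp only [or_comm, eq_comm]

theorem abs_blockSign_le_one (a b : Fin 5) : |blockSign a b| ≤ 1 := by
  unfold blockSign
  split_ifs <;> simp

/-- The sum over the assignments of points to the vertices `a, b, c, d` of the product of
`blockSign` over a selection of the six pairs. -/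
def fourSum (b₁ b₂ b₃ b₄ b₅ b₆ : Bool) : ℤ :=
  ∑ a, ∑ b, (bif b₁ then blockSign a b else 1) *
    ∑ c, (bif b₂ then blockSign a c else 1) * (bif b₃ then blockSign b c else 1) *
      ∑ d, (bif b₄ then blockSign a d else 1) * (bif b₅ then blockSign b d else 1) *
        (bif b₆ then blockSign c d else 1)

theorem fourSum_cases : ∀ b₁ b₂ b₃ b₄ b₅ b₆ : Bool,
    (b₁.toNat + b₂.toNat + b₃.toNat + b₄.toNat + b₅.toNat + b₆.toNat = 1 →
      fourSum b₁ b₂ b₃ b₄ b₅ b₆ = -200) ∧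
    (2 ≤ b₁.toNat + b₂.toNat + b₃.toNat + b₄.toNat + b₅.toNat + b₆.toNat →
      |fourSum b₁ b₂ b₃ b₄ b₅ b₆| < 128 ∨
        b₁.toNat + b₂.toNat + b₃.toNat + b₄.toNat + b₅.toNat + b₆.toNat = 6) ∧
    (b₁.toNat + b₂.toNat + b₃.toNat + b₄.toNat + b₅.toNat + b₆.toNat = 6 →
      fourSum b₁ b₂ b₃ b₄ b₅ b₆ = -128) := by
  decide +kernel

section SignDensity

variable {A V : Type*}

/-- The value of `blockSign` on the endpoints of an edge. -/
def edgeSign (x : V → Fin 5) : Sym2 V → ℤ :=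
  Sym2.lift ⟨fun u v => blockSign (x u) (x v), fun _ _ => blockSign_comm _ _⟩

@[simp] theorem edgeSign_mk (x : V → Fin 5) (u v : V) :
    edgeSign x s(u, v) = blockSign (x u) (x v) := rfl

theorem edgeSign_map (ι : A → V) (x : V → Fin 5) (e : Sym2 A) :
    edgeSign x (e.map ι) = edgeSign (x ∘ ι) e := by
  induction e with | _ u v => rfl

theorem abs_edgeSign_le_one (x : V → Fin 5) (e : Sym2 V) : |edgeSign x e| ≤ 1 := by
  induction e with | _ u v => exact abs_blockSign_le_one _ _

theorem edgeSign_congr {x y : V → Fin 5} {e : Sym2 V} (h : ∀ v ∈ e, x v = y v) :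
    edgeSign x e = edgeSign y e := by
  induction e with | _ u v => simp [h u (by simp), h v (by simp)]

theorem edgeSign_eq_zero {x : V → Fin 5} {e : Sym2 V} {v : V} (hv : v ∈ e) (h : x v = 0) :
    edgeSign x e = 0 := by
  induction e with | _ a b =>
    rcases Sym2.mem_iff.1 hv with rfl | rfl <;> simp [blockSign, h]

theorem abs_prod_edgeSign_le_one (x : V → Fin 5) (F : Finset (Sym2 V)) :
    |∏ e ∈ F, edgeSign x e| ≤ 1 := by
  rw [Finset.abs_prod]
  exact Finset.prod_le_one (fun _ _ => abs_nonneg _) fun _ _ => abs_edgeSign_le_one _ _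

variable [Fintype A] [Fintype V] [DecidableEq A] [DecidableEq V]

/-- The density in `blockSign` of the graph with edge set `F`, for independent uniform points. -/
noncomputable def signDensity (F : Finset (Sym2 V)) : ℝ :=
  ((∑ x : V → Fin 5, ∏ e ∈ F, edgeSign x e : ℤ) : ℝ) / 5 ^ Fintype.card V

theorem sum_comp_injective (ι : A → V) (hι : Function.Injective ι) (f : (A → Fin 5) → ℤ) :
    ∑ x : V → Fin 5, f (x ∘ ι) * 5 ^ Fintype.card A = (∑ y, f y) * 5 ^ Fintype.card V := by
  classical
  let s : A ⊕ {v // v ∉ Set.range ι} ≃ V :=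
    ((Equiv.ofInjective ι hι).sumCongr (Equiv.refl _)).trans (Equiv.Set.sumCompl (Set.range ι))
  have hcard := Fintype.card_congr s
  rw [Fintype.card_sum] at hcard
  have hsum : ∑ x : V → Fin 5, f (x ∘ ι) =
      ∑ p : (A → Fin 5) × ({v // v ∉ Set.range ι} → Fin 5), f p.1 := by
    refine Fintype.sum_equiv
      ((s.symm.arrowCongr (Equiv.refl _)).trans (Equiv.sumArrowEquivProdArrow _ _ _)) _ _
      fun x => ?_
    congr 1
  rw [← Finset.sum_mul, hsum, Fintype.sum_prod_type, ← hcard, pow_add]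
  simp only [Finset.sum_const, Finset.card_univ, Fintype.card_fun, Fintype.card_fin,
    nsmul_eq_mul, ← Finset.mul_sum]
  push_cast
  ring

theorem signDensity_image (ι : A → V) (hι : Function.Injective ι) (F : Finset (Sym2 A)) :
    signDensity (F.image (Sym2.map ι)) = signDensity F := by
  have h := sum_comp_injective ι hι fun y => ∏ e ∈ F, edgeSign y e
  rw [← Finset.sum_mul] at h
  unfold signDensity
  rw [div_eq_div_iff (by positivity) (by positivity)]
  simp only [Finset.prod_image (Sym2.map.injective hι).injOn, edgeSign_map]
  exact_mod_cast h

end SignDensity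

/-- An edge set on `Fin 4` is determined by the selection of the six pairs belonging to it. -/
theorem fourSum_eq (F : Finset (Sym2 (Fin 4))) (hF : ∀ e ∈ F, ¬ e.IsDiag) :
    F.card = (decide (s(0, 1) ∈ F)).toNat + (decide (s(0, 2) ∈ F)).toNat +
      (decide (s(1, 2) ∈ F)).toNat + (decide (s(0, 3) ∈ F)).toNat +
      (decide (s(1, 3) ∈ F)).toNat + (decide (s(2, 3) ∈ F)).toNat ∧
    ∑ x : Fin 4 → Fin 5, ∏ e ∈ F, edgeSign x e =
      fourSum (s(0, 1) ∈ F) (s(0, 2) ∈ F) (s(1, 2) ∈ F) (s(0, 3) ∈ F) (s(1, 3) ∈ F)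
        (s(2, 3) ∈ F) := by
  let E : Finset (Sym2 (Fin 4)) := {s(0, 1), s(0, 2), s(1, 2), s(0, 3), s(1, 3), s(2, 3)}
  have hE : ∀ e : Sym2 (Fin 4), ¬ e.IsDiag → e ∈ E := by decide
  have hFE : E ∩ F = F := Finset.inter_eq_right.2 fun e he => hE e (hF e he)
  constructor
  · have : F.card = ∑ e ∈ E, if e ∈ F then 1 else 0 := by
      rw [Finset.sum_ite_mem, hFE, Finset.card_eq_sum_ones]
    rw [this]
    simp only [E]
    repeat rw [Finset.sum_insert (by decide)]
    rw [Finset.sum_singleton]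
    simp only [Bool.toNat, Bool.cond_decide]
    ring
  · let s : (Fin 4 → Fin 5) ≃ Fin 5 × Fin 5 × Fin 5 × Fin 5 :=
      { toFun := fun x => (x 0, x 1, x 2, x 3)
        invFun := fun p => ![p.1, p.2.1, p.2.2.1, p.2.2.2]
        left_inv := fun x => by ext i; fin_cases i <;> rfl
        right_inv := fun p => rfl }
    have hs : ∀ a b c d, s.symm (a, b, c, d) = ![a, b, c, d] := fun _ _ _ _ => rfl
    rw [← s.symm.sum_comp]
    simp only [Fintype.sum_prod_type, fourSum, Finset.mul_sum]
    refine Finset.sum_congr rfl fun a _ => Finset.sum_congr rfl fun b _ =>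
      Finset.sum_congr rfl fun c _ => Finset.sum_congr rfl fun d _ => ?_
    rw [← hFE, ← Finset.prod_ite_mem, hFE]
    simp only [E]
    repeat rw [Finset.prod_insert (by decide)]
    rw [Finset.prod_singleton]
    simp only [Bool.cond_decide, edgeSign_mk, hs, Matrix.cons_val]
    ring

theorem signDensity_fin_four (F : Finset (Sym2 (Fin 4))) (hF : ∀ e ∈ F, ¬ e.IsDiag) :
    (F.card = 1 → signDensity F = -200 / 625) ∧
    (2 ≤ F.card → |signDensity F| < 128 / 625 ∨ F.card = 6) ∧
    (F.card = 6 → signDensity F = -128 / 625) := by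
  obtain ⟨hcard, hsum⟩ := fourSum_eq F hF
  have h := fourSum_cases (s(0, 1) ∈ F) (s(0, 2) ∈ F) (s(1, 2) ∈ F) (s(0, 3) ∈ F) (s(1, 3) ∈ F)
        (s(2, 3) ∈ F)
  rw [← hcard, ← hsum] at h
  unfold signDensity
  norm_num only [Fintype.card_fin]
  refine ⟨fun h1 => ?_, fun h2 => (h.2.1 h2).imp_left fun h3 => ?_, fun h6 => ?_⟩
  · rw [h.1 h1]; norm_num
  · rw [abs_div, abs_of_pos (by norm_num : (0:ℝ) < 625), div_lt_div_iff_of_pos_right (by norm_num)]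
    exact_mod_cast h3
  · rw [h.2.2 h6]; norm_num

theorem abs_bilinear_blockSign_le (f g : Fin 5 → ℤ) (hf : ∀ a, |f a| ≤ 1) (hg : ∀ a, |g a| ≤ 1) :
    |∑ a, ∑ b, f a * g b * blockSign a b| ≤ 8 := by
  have hf' := fun a => (sq_le_one_iff_abs_le_one (f a)).2 (hf a)
  have hg' := fun a => (sq_le_one_iff_abs_le_one (g a)).2 (hg a)
  let h : Fin 5 → ℤ := fun a => ∑ b, g b * blockSign a b
  have hS : ∑ a, ∑ b, f a * g b * blockSign a b = ∑ a, f a * h a := by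
    simp only [h, Finset.mul_sum, mul_assoc]
  have hh : ∑ a, h a ^ 2 = 4 * (g 1 ^ 2 + g 2 ^ 2 + g 3 ^ 2 + g 4 ^ 2) := by
    simp [h, Fin.sum_univ_five, blockSign]
    ring
  have h0 : h 0 = 0 := by simp [h, blockSign]
  rw [hS]
  rw [Fin.sum_univ_five, h0] at hh ⊢
  rw [abs_le]
  constructor
  · nlinarith [sq_nonneg (2 * f 1 + h 1), sq_nonneg (2 * f 2 + h 2), sq_nonneg (2 * f 3 + h 3),
      sq_nonneg (2 * f 4 + h 4), hf' 1, hf' 2, hf' 3, hf' 4, hg' 1, hg' 2, hg' 3, hg' 4]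
  · nlinarith [sq_nonneg (2 * f 1 - h 1), sq_nonneg (2 * f 2 - h 2), sq_nonneg (2 * f 3 - h 3),
      sq_nonneg (2 * f 4 - h 4), hf' 1, hf' 2, hf' 3, hf' 4, hg' 1, hg' 2, hg' 3, hg' 4]

theorem abs_sum_sum_prod_edgeSign_le {V : Type*} [DecidableEq V] (F : Finset (Sym2 V)) {u v : V}
    (huv : u ≠ v) (he : s(u, v) ∈ F) (x : V → Fin 5) :
    |∑ a, ∑ b, ∏ e ∈ F, edgeSign (Function.update (Function.update x u a) v b) e| ≤ 8 := by
  let P := F.erase s(u, v)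
  let f : Fin 5 → ℤ := fun a => ∏ e ∈ P with u ∈ e, edgeSign (Function.update x u a) e
  let g : Fin 5 → ℤ := fun b => ∏ e ∈ P with u ∉ e, edgeSign (Function.update x v b) e
  have hP : ∀ a b, ∏ e ∈ F, edgeSign (Function.update (Function.update x u a) v b) e =
      f a * g b * blockSign a b := by
    intro a b
    rw [← Finset.mul_prod_erase F _ he, ← Finset.prod_filter_mul_prod_filter_not _ (u ∈ ·),
      mul_comm]
    congr 1
    · congr 1 <;> refine Finset.prod_congr rfl fun e hmem => edgeSign_congr fun w hw => ?_
      · obtain ⟨hmem, hu⟩ := Finset.mem_filter.1 hmem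
        have : w ≠ v := by
          rintro rfl
          exact (Finset.mem_erase.1 hmem).1 ((Sym2.mem_and_mem_iff huv).1 ⟨hu, hw⟩)
        simp [this]
      · have hu := (Finset.mem_filter.1 hmem).2
        have : w ≠ u := by
          rintro rfl
          exact hu hw
        by_cases hwv : w = v
        · subst hwv
          simp
        · simp [this, hwv]
    · simp [huv]
  simp only [hP]
  exact abs_bilinear_blockSign_le f g (fun _ => abs_prod_edgeSign_le_one _ _)
    fun _ => abs_prod_edgeSign_le_one _ _

section SignDensityBounds

variable {V : Type*} [Fintype V] [DecidableEq V]

theorem sum_sum_update (h : (V → Fin 5) → ℤ) (u : V) :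
    ∑ x, ∑ a, h (Function.update x u a) = 5 * ∑ x, h x := by
  let s : (V → Fin 5) × Fin 5 → (V → Fin 5) × Fin 5 := fun p => (Function.update p.1 u p.2, p.1 u)
  have hs : Function.Involutive s := fun p => by simp [s]
  have h1 : ∑ p : (V → Fin 5) × Fin 5, h (Function.update p.1 u p.2) =
      ∑ p : (V → Fin 5) × Fin 5, h p.1 :=
    Fintype.sum_equiv hs.toPerm _ _ fun p => rfl
  rw [Fintype.sum_prod_type, Fintype.sum_prod_type] at h1
  simpa [← Finset.mul_sum] using h1

theorem sum_prod_indicator (R : Finset V) :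
    (∑ x : V → Fin 5, ∏ s ∈ R, if x s = 0 then (0 : ℤ) else 1) * 5 ^ R.card =
      4 ^ R.card * 5 ^ Fintype.card V := by
  have h := sum_comp_injective (Subtype.val : R → V) Subtype.val_injective
    fun y => ∏ s, if y s = 0 then (0 : ℤ) else 1
  have h4 : ∑ a : Fin 5, (if a = 0 then (0 : ℤ) else 1) = 4 := by decide
  rw [← Finset.sum_mul, Fintype.card_coe,
    ← Fintype.prod_sum fun (_ : R) (a : Fin 5) => if a = 0 then (0 : ℤ) else 1] at h
  simp only [h4, Finset.prod_const, Finset.card_univ, Fintype.card_coe, Function.comp_apply] at h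
  rw [← h]
  congr 2 with x
  rw [← Finset.prod_coe_sort]

theorem abs_signDensity_lt_of_five_le (F : Finset (Sym2 V)) (hF : ∀ e ∈ F, ¬ e.IsDiag)
    (S : Finset V) (hS : ∀ v ∈ S, ∃ e ∈ F, v ∈ e) (hcard : 5 ≤ S.card) :
    |signDensity F| < 128 / 625 := by
  obtain ⟨e, he⟩ : ∃ e, e ∈ F := by
    obtain ⟨v, hv⟩ := Finset.card_pos.1 (by omega : 0 < S.card)
    obtain ⟨e, he, -⟩ := hS v hv
    exact ⟨e, he⟩
  induction e with | _ u v =>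
  have huv : u ≠ v := hF _ he
  obtain ⟨R, hRS, hR⟩ := Finset.exists_subset_card_eq
    (show 3 ≤ (S \ {u, v}).card by
      have := Finset.le_card_sdiff {u, v} S
      have := Finset.card_le_two (a := u) (b := v)
      omega)
  have hinner : ∀ x : V → Fin 5,
      |∑ a, ∑ b, ∏ e ∈ F, edgeSign (Function.update (Function.update x u a) v b) e| ≤
        8 * ∏ s ∈ R, if x s = 0 then (0 : ℤ) else 1 := by
    intro x
    by_cases hx : ∃ s ∈ R, x s = 0
    · obtain ⟨s, hs, hxs⟩ := hx
      have hsS := Finset.mem_sdiff.1 (hRS hs)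
      obtain ⟨d, hd, hsd⟩ := hS s hsS.1
      simp only [Finset.mem_insert, Finset.mem_singleton, not_or] at hsS
      have hzero : ∀ a b,
          ∏ e ∈ F, edgeSign (Function.update (Function.update x u a) v b) e = 0 := fun a b =>
        Finset.prod_eq_zero hd (edgeSign_eq_zero hsd (by simp [hsS.2.1, hsS.2.2, hxs]))
      rw [Finset.prod_eq_zero hs (by simp [hxs])]
      simp [hzero]
    · push Not at hx
      rw [Finset.prod_congr rfl fun s hs => if_neg (hx s hs)]
      simpa using abs_sum_sum_prod_edgeSign_le F huv he x
  have hsum : 25 * ∑ x : V → Fin 5, ∏ e ∈ F, edgeSign x e = ∑ x : V → Fin 5,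
      ∑ a, ∑ b, ∏ e ∈ F, edgeSign (Function.update (Function.update x u a) v b) e := by
    rw [sum_sum_update (fun y => ∑ b, ∏ e ∈ F, edgeSign (Function.update y v b) e) u,
      sum_sum_update (fun y => ∏ e ∈ F, edgeSign y e) v]
    ring
  have hbound : 25 * |∑ x : V → Fin 5, ∏ e ∈ F, edgeSign x e| ≤
      8 * ∑ x : V → Fin 5, ∏ s ∈ R, if x s = 0 then (0 : ℤ) else 1 := by
    rw [← abs_of_pos (by norm_num : (0 : ℤ) < 25), ← abs_mul, hsum, Finset.mul_sum]
    exact (Finset.abs_sum_le_sum_abs _ _).trans (Finset.sum_le_sum fun x _ => hinner x)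
  have hR' := sum_prod_indicator R
  rw [hR] at hR'
  have hpos : (0 : ℤ) < 5 ^ Fintype.card V := by positivity
  have hfin : |∑ x : V → Fin 5, ∏ e ∈ F, edgeSign x e| * 625 < 128 * 5 ^ Fintype.card V := by
    linarith
  unfold signDensity
  rw [abs_div, abs_of_pos (by positivity : (0 : ℝ) < 5 ^ Fintype.card V),
    div_lt_div_iff₀ (by positivity) (by norm_num)]
  exact_mod_cast hfin

theorem signDensity_cases (F : Finset (Sym2 V)) (hF : ∀ e ∈ F, ¬ e.IsDiag) :
    (F.card = 1 → signDensity F = -200 / 625) ∧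
    (2 ≤ F.card → |signDensity F| < 128 / 625 ∨ F.card = 6 ∧ signDensity F = -128 / 625) := by
  let S : Finset V := {v | ∃ e ∈ F, v ∈ e}
  have hS : ∀ v ∈ S, ∃ e ∈ F, v ∈ e := by simp [S]
  rcases le_or_gt 5 S.card with h5 | h4
  · refine ⟨fun h1 => ?_, fun _ => Or.inl (abs_signDensity_lt_of_five_le F hF S hS h5)⟩
    obtain ⟨e, rfl⟩ := Finset.card_eq_one.1 h1
    induction e with | _ a b =>
    have : S ⊆ {a, b} := fun v hv => by simpa using hS v hv
    have := (Finset.card_le_card this).trans Finset.card_le_two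
    omega
  · let FS : Finset (Sym2 S) := {e | e.map Subtype.val ∈ F}
    have hFS : FS.image (Sym2.map Subtype.val) = F := by
      ext e
      simp only [Finset.mem_image, FS, Finset.mem_filter, Finset.mem_univ, true_and]
      refine ⟨fun ⟨d, hd, h⟩ => h ▸ hd, fun he => ?_⟩
      induction e with | _ a b =>
      exact ⟨s(⟨a, by simpa [S] using ⟨_, he, Sym2.mem_mk_left a b⟩⟩,
        ⟨b, by simpa [S] using ⟨_, he, Sym2.mem_mk_right a b⟩⟩), he, rfl⟩
    obtain ⟨j⟩ : Nonempty (S ↪ Fin 4) :=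
      Function.Embedding.nonempty_of_card_le (by simpa using Nat.lt_succ_iff.1 h4)
    have hcard : (FS.image (Sym2.map j)).card = F.card := by
      rw [Finset.card_image_of_injective _ (Sym2.map.injective j.injective), ← hFS,
        Finset.card_image_of_injective _ (Sym2.map.injective Subtype.val_injective)]
    have hdens : signDensity (FS.image (Sym2.map j)) = signDensity F := by
      rw [signDensity_image j j.injective, ← signDensity_image _ Subtype.val_injective FS, hFS]
    have hdiag : ∀ e ∈ FS.image (Sym2.map j), ¬ e.IsDiag := by
      intro e he
      obtain ⟨d, hd, rfl⟩ := Finset.mem_image.1 he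
      rw [Sym2.isDiag_map j.injective, ← Sym2.isDiag_map Subtype.val_injective]
      exact hF _ (by simpa [FS] using hd)
    obtain ⟨h1, h2, h6⟩ := signDensity_fin_four _ hdiag
    rw [hcard, hdens] at h1 h2 h6
    exact ⟨h1, fun h => (h2 h).imp_right fun h' => ⟨h', h6 h'⟩⟩

theorem exists_signDensity_eq_of_not_cliqueFree {G : SimpleGraph V} [DecidableRel G.Adj]
    (hG : ¬ G.CliqueFree 4) :
    ∃ F ⊆ G.edgeFinset, F.card = 6 ∧ signDensity F = -128 / 625 := by
  let ι := SimpleGraph.topEmbeddingOfNotCliqueFree hG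
  let E : Finset (Sym2 (Fin 4)) := {e | ¬ e.IsDiag}
  have hE : E.card = 6 := by decide
  refine ⟨E.image (Sym2.map ι), ?_, ?_, ?_⟩
  · intro e he
    obtain ⟨d, hd, rfl⟩ := Finset.mem_image.1 he
    induction d with | _ a b =>
    have : a ≠ b := by simpa [E] using hd
    simpa using this
  · rw [Finset.card_image_of_injective _ (Sym2.map.injective ι.injective), hE]
  · rw [signDensity_image ι ι.injective]
    exact (signDensity_fin_four E (by simp [E])).2.2 hE

end SignDensityBounds

section UnitInterval

/-- Every nonempty finite type carries its uniform distribution as an image of `unitM`. -/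
theorem exists_measurable_uniform (T : Type*) [Fintype T] [Nonempty T] [MeasurableSpace T]
    [MeasurableSingletonClass T] [StandardBorelSpace T] :
    ∃ φ : ℝ → T, Measurable φ ∧ ∀ t, unitM.map φ {t} = (Fintype.card T : ENNReal)⁻¹ := by
  obtain ⟨f, hf, hmap⟩ := (PMF.uniformOfFintype T).toMeasure.exists_measurable_map_eq
  have hproj : Measurable (Set.projIcc (0 : ℝ) 1 zero_le_one) := continuous_projIcc.measurable
  refine ⟨f ∘ Set.projIcc 0 1 zero_le_one, hf.comp hproj, fun t => ?_⟩
  have hunit : unitM.map (Set.projIcc 0 1 zero_le_one) = (volume : Measure unitInterval) := by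
    rw [unitM, ← unitInterval.measurePreserving_coe.map_eq,
      Measure.map_map hproj measurable_subtype_coe]
    convert! Measure.map_id
    ext x
    simp
  rw [← Measure.map_map hf hproj, hunit, hmap,
    PMF.toMeasure_apply_singleton _ _ (measurableSet_singleton t), PMF.uniformOfFintype_apply]

theorem integral_comp_uniform {V T : Type*} [Fintype V] [DecidableEq V] [Fintype T]
    [MeasurableSpace T] [DiscreteMeasurableSpace T] {φ : ℝ → T} (hφ : Measurable φ)
    (huniform : ∀ t, unitM.map φ {t} = (Fintype.card T : ENNReal)⁻¹) (g : (V → T) → ℝ) :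
    ∫ x : V → ℝ, g (fun v => φ (x v)) ∂(Measure.pi fun _ => unitM) =
      (∑ y, g y) / (Fintype.card T : ℝ) ^ Fintype.card V := by
  have : IsFiniteMeasure unitM := by unfold unitM; infer_instance
  have hmap := Measure.pi_map_pi (μ := fun _ : V => unitM) (f := fun _ => φ)
    fun _ => hφ.aemeasurable
  have hmeas : Measurable fun (x : V → ℝ) v => φ (x v) := by fun_prop
  rw [← integral_map (f := g) hmeas.aemeasurable (by fun_prop), hmap,
    integral_fintype .of_finite, Finset.sum_div]
  refine Finset.sum_congr rfl fun y _ => ?_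
  simp only [measureReal_def, Measure.pi_singleton, huniform, Finset.prod_const, Finset.card_univ,
    ENNReal.toReal_pow, ENNReal.toReal_inv, ENNReal.toReal_natCast, smul_eq_mul, inv_pow]
  exact inv_mul_eq_div _ _

end UnitInterval

section SignPower

variable {k : ℕ}

/-- The `k`-th tensor power of `blockSign`, transported to the real line along `φ`. -/
def signPower (φ : ℝ → Fin k → Fin 5) (x y : ℝ) : ℝ := ∏ i, (blockSign (φ x i) (φ y i) : ℝ)

theorem signPower_comm (φ : ℝ → Fin k → Fin 5) (x y : ℝ) : signPower φ x y = signPower φ y x := by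
  simp only [signPower, blockSign_comm]

theorem abs_signPower_le_one (φ : ℝ → Fin k → Fin 5) (x y : ℝ) : |signPower φ x y| ≤ 1 := by
  rw [signPower, Finset.abs_prod]
  exact Finset.prod_le_one (fun _ _ => abs_nonneg _) fun _ _ => by
    exact_mod_cast abs_blockSign_le_one _ _

theorem measurable_signPower {φ : ℝ → Fin k → Fin 5} (hφ : Measurable φ) :
    Measurable (Function.uncurry (signPower φ)) := by
  have hsign : Measurable fun q : Fin 5 × Fin 5 => (blockSign q.1 q.2 : ℝ) :=
    measurable_of_finite _
  change Measurable fun p : ℝ × ℝ => ∏ i, (blockSign (φ p.1 i) (φ p.2 i) : ℝ)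
  refine Finset.measurable_prod _ fun i _ => hsign.comp (Measurable.prodMk ?_ ?_)
  · exact (measurable_pi_apply i).comp (hφ.comp measurable_fst)
  · exact (measurable_pi_apply i).comp (hφ.comp measurable_snd)

theorem sum_prod_prod_edgeSign {V : Type*} [Fintype V] [DecidableEq V] (F : Finset (Sym2 V)) :
    (∑ y : V → Fin k → Fin 5, ∏ e ∈ F, ∏ i, (edgeSign (fun v => y v i) e : ℝ)) /
      (Fintype.card (Fin k → Fin 5) : ℝ) ^ Fintype.card V = signDensity F ^ k := by
  rw [signDensity, div_pow]
  congr 1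
  · push_cast
    rw [Fintype.sum_pow]
    refine Fintype.sum_equiv (Equiv.piComm fun _ _ => Fin 5) _ _ fun y => ?_
    rw [Finset.prod_comm]
    rfl
  · simp only [Fintype.card_fun, Fintype.card_fin]
    push_cast
    rw [← pow_mul, ← pow_mul, mul_comm]

open Classical in
theorem homDensity_signPower {V : Type*} [Fintype V] (G : SimpleGraph V) {φ : ℝ → Fin k → Fin 5}
    (hφ : Measurable φ)
    (huniform : ∀ t, unitM.map φ {t} = (Fintype.card (Fin k → Fin 5) : ENNReal)⁻¹) (ε p : ℝ) :
    homDensity G (fun x y => ε * signPower φ x y + p) =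
      ∑ F ∈ G.edgeFinset.powerset,
        ε ^ F.card * p ^ (G.edgeFinset.card - F.card) * signDensity F ^ k := by
  have hedge : ∀ (x : V → ℝ) (e : Sym2 V),
      symEdge (fun x y => ε * signPower φ x y + p) x e =
        ε * ∏ i, (edgeSign (fun v => φ (x v) i) e : ℝ) + p := by
    intro x e
    induction e with | _ u v =>
    change (ε * signPower φ (x u) (x v) + p + (ε * signPower φ (x v) (x u) + p)) / 2 =
      ε * signPower φ (x u) (x v) + p
    rw [signPower_comm φ (x v)]
    ring
  simp only [homDensity, hedge]
  rw [integral_comp_uniform hφ huniform fun y =>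
    ∏ e ∈ G.edgeFinset, (ε * ∏ i, (edgeSign (fun v => y v i) e : ℝ) + p)]
  simp only [Finset.prod_add, Finset.prod_mul_distrib, Finset.prod_const]
  rw [Finset.sum_comm, Finset.sum_div]
  refine Finset.sum_congr rfl fun F hF => ?_
  rw [← sum_prod_prod_edgeSign, Finset.card_sdiff_of_subset (Finset.mem_powerset.1 hF),
    ← Finset.sum_mul, ← Finset.mul_sum]
  ring

end SignPower

section Expansion

open Filter Topology

variable {V : Type*} [Fintype V]

open Classical in
/-- The contribution of the edge sets with at least two edges to the density of `G` in a
perturbation of the constant `p`, in units of `p ^ e(G)`. -/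
noncomputable def higherTerms (G : SimpleGraph V) (r : ℝ) (k : ℕ) : ℝ :=
  ∑ F ∈ G.edgeFinset.powerset with 2 ≤ F.card, r ^ F.card * signDensity F ^ k

open Classical in
theorem eCount_eq (G : SimpleGraph V) : eCount G = G.edgeFinset.card := by
  rw [eCount, ← SimpleGraph.coe_edgeFinset, Set.ncard_coe_finset]

theorem homDensity_signPower_div (G : SimpleGraph V) {k : ℕ} {φ : ℝ → Fin k → Fin 5}
    (hφ : Measurable φ)
    (huniform : ∀ t, unitM.map φ {t} = (Fintype.card (Fin k → Fin 5) : ENNReal)⁻¹)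
    {ε p : ℝ} (hp : 0 < p) (hG : eCount G ≠ 0) :
    homDensity G (fun x y => ε * signPower φ x y + p) / (eCount G * p ^ (eCount G - 1)) =
      p / eCount G + ε * (-200 / 625) ^ k + p / eCount G * higherTerms G (ε / p) k := by
  classical
  rw [homDensity_signPower G hφ huniform]
  have hm := eCount_eq G
  set E := G.edgeFinset with hE
  set m := eCount G
  have hdiag : ∀ F ∈ E.powerset, ∀ e ∈ F, ¬ e.IsDiag := fun F hF e he =>
    G.not_isDiag_of_mem_edgeFinset (Finset.mem_powerset.1 hF he)
  have hterm : ∀ F ∈ E.powerset, ε ^ F.card * p ^ (E.card - F.card) * signDensity F ^ k =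
      p ^ m * ((ε / p) ^ F.card * signDensity F ^ k) := by
    intro F hF
    have hle := Finset.card_le_card (Finset.mem_powerset.1 hF)
    rw [hm, div_pow, ← Nat.sub_add_cancel hle, pow_add]
    field_simp
    rw [Nat.sub_add_cancel hle]
    ring
  have hlow : {F ∈ E.powerset | ¬ 2 ≤ F.card} = E.powersetCard 0 ∪ E.powersetCard 1 := by
    ext F
    simp only [Finset.mem_filter, Finset.mem_powerset, Finset.mem_union, Finset.mem_powersetCard]
    rw [← and_or_left]
    exact and_congr_right fun _ => by omega
  have hone : ∑ F ∈ E.powersetCard 1, (ε / p) ^ F.card * signDensity F ^ k =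
      m * (ε / p * (-200 / 625) ^ k) := by
    rw [Finset.sum_congr rfl fun F hF => ?_, Finset.sum_const, Finset.card_powersetCard,
      Nat.choose_one_right, nsmul_eq_mul, hm]
    obtain ⟨hFE, hF1⟩ := Finset.mem_powersetCard.1 hF
    rw [(signDensity_cases F (hdiag F (Finset.mem_powerset.2 hFE))).1 hF1, hF1, pow_one]
  have hzero : ∑ F ∈ E.powersetCard 0, (ε / p) ^ F.card * signDensity F ^ k = 1 := by
    simp [signDensity]
  have hdisj : Disjoint (E.powersetCard 0) (E.powersetCard 1) :=
    Finset.pairwise_disjoint_powersetCard E zero_ne_one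
  rw [Finset.sum_congr rfl hterm, ← Finset.mul_sum,
    ← Finset.sum_filter_add_sum_filter_not _ (2 ≤ ·.card), hlow, Finset.sum_union hdisj,
    hzero, hone]
  change p ^ m * (higherTerms G (ε / p) k + _) / _ = _
  have hm0 : (m : ℝ) ≠ 0 := by exact_mod_cast hG
  have hpow : p ^ m = p ^ (m - 1) * p := by rw [← pow_succ, Nat.sub_add_cancel (by omega)]
  rw [hpow]
  field_simp
  ring

theorem exists_tendsto_higherTerms (G : SimpleGraph V) {r : ℝ} (hr : r ≠ 0) :
    ∃ L : ℝ, 0 ≤ L ∧ (¬ G.CliqueFree 4 → 0 < L) ∧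
      Tendsto (fun n : ℕ => higherTerms G r (2 * n + 1) / (128 / 625) ^ (2 * n + 1)) atTop
        (𝓝 (-L)) := by
  classical
  have hdiag : ∀ F ∈ G.edgeFinset.powerset, ∀ e ∈ F, ¬ e.IsDiag := fun F hF e he =>
    G.not_isDiag_of_mem_edgeFinset (Finset.mem_powerset.1 hF he)
  let c : Finset (Sym2 V) → ℝ := fun F =>
    if F.card = 6 ∧ signDensity F = -128 / 625 then r ^ 6 else 0
  have hr6 : 0 < r ^ 6 := by positivity
  have hc : ∀ F, 0 ≤ c F := fun F => by
    unfold c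
    split_ifs <;> positivity
  refine ⟨∑ F ∈ G.edgeFinset.powerset with 2 ≤ F.card, c F,
    Finset.sum_nonneg fun F _ => hc F, ?_, ?_⟩
  · intro hG
    obtain ⟨F, hF, hcard, hdens⟩ := exists_signDensity_eq_of_not_cliqueFree hG
    refine Finset.sum_pos' (fun F _ => hc F) ⟨F, ?_, ?_⟩
    · simp [hcard, Finset.mem_filter, hF]
    · simp only [c, hcard, hdens, and_self, if_true]
      exact hr6
  · simp only [higherTerms, Finset.sum_div, ← Finset.sum_neg_distrib]
    refine tendsto_finsetSum _ fun F hF => ?_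
    obtain ⟨hFE, hF2⟩ := Finset.mem_filter.1 hF
    simp only [mul_div_assoc, ← div_pow]
    rcases (signDensity_cases F (hdiag F hFE)).2 hF2 with hlt | ⟨h6, hdens⟩
    · have hne : ¬ (F.card = 6 ∧ signDensity F = -128 / 625) := by
        rintro ⟨-, h⟩
        rw [h] at hlt
        norm_num [abs_lt] at hlt
      have hq : |signDensity F / (128 / 625)| < 1 := by
        rwa [abs_div, abs_of_pos (by norm_num : (0 : ℝ) < 128 / 625), div_lt_one (by norm_num)]
      have hodd : Tendsto (fun n : ℕ => 2 * n + 1) atTop atTop :=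
        tendsto_atTop_mono (fun n => by simp only [id]; omega) tendsto_id
      simpa [c, hne] using
        ((tendsto_pow_atTop_nhds_zero_of_abs_lt_one hq).comp hodd).const_mul (r ^ F.card)
    · have hq : signDensity F / (128 / 625) = -1 := by
        rw [hdens]
        norm_num
      have hpow : ∀ n : ℕ, (-1 : ℝ) ^ (2 * n + 1) = -1 := fun n => by simp [pow_succ, pow_mul]
      simp only [hq, hpow]
      simp only [c, h6, hdens, and_self, if_true, mul_neg_one]
      exact tendsto_const_nhds

theorem homDensity_zero {G : SimpleGraph V} (hG : eCount G ≠ 0) :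
    homDensity G (fun _ _ => 0) = 0 := by
  classical
  rw [eCount_eq, Finset.card_ne_zero] at hG
  obtain ⟨e, he⟩ := hG
  have hzero : ∀ x : V → ℝ, ∏ e ∈ G.edgeFinset, symEdge (fun _ _ => 0) x e = 0 := fun x =>
    Finset.prod_eq_zero he (by induction e with | _ u v => simp [symEdge])
  rw [homDensity]
  simp [hzero]

theorem cliqueFree_four_of_eCount_eq_zero {G : SimpleGraph V} (hG : eCount G = 0) :
    G.CliqueFree 4 := by
  classical
  by_contra h
  obtain ⟨F, hF, h6, -⟩ := exists_signDensity_eq_of_not_cliqueFree h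
  have := Finset.card_le_card hF
  rw [← eCount_eq] at this
  omega

end Expansion

section CommonPair

variable {V₁ V₂ : Type*} [Fintype V₁] [Fintype V₂] {G₁ : SimpleGraph V₁} {G₂ : SimpleGraph V₂}
  {p₁ p₂ : ℝ}

theorem IsCommonPair.symm (h : IsCommonPair G₁ G₂ p₁ p₂) : IsCommonPair G₂ G₁ p₂ p₁ := by
  intro W₁ W₂ h₁ h₂ hW
  have := h W₂ W₁ h₂ h₁ fun x y => by rw [add_comm, hW]
  linarith

theorem IsCommonPair.eCount_eq_zero (h : IsCommonPair G₁ G₂ p₁ p₂) (hp₂ : 0 < p₂)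
    (h₁ : eCount G₁ = 0) : eCount G₂ = 0 := by
  by_contra h₂
  have := h (fun _ _ => 1) (fun _ _ => 0) ⟨measurable_const, fun _ _ => rfl, by simp⟩
    ⟨measurable_const, fun _ _ => rfl, by simp⟩ (by simp)
  rw [homDensity_zero h₂, h₁] at this
  have hpos : 0 < p₂ / eCount G₂ := div_pos hp₂ (by exact_mod_cast Nat.pos_of_ne_zero h₂)
  simp at this
  linarith

theorem isGraphon_signPower {k : ℕ} {φ : ℝ → Fin k → Fin 5} (hφ : Measurable φ) {ε p : ℝ}
    (h₀ : |ε| ≤ p) (h₁ : |ε| ≤ 1 - p) : IsGraphon fun x y => ε * signPower φ x y + p := by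
  refine ⟨((measurable_signPower hφ).const_mul ε).add_const p, fun x y => ?_, fun x y => ?_⟩
  · simp only [signPower_comm φ x y]
  · have : |ε * signPower φ x y| ≤ |ε| := by
      rw [abs_mul]
      exact mul_le_of_le_one_right (abs_nonneg _) (abs_signPower_le_one φ x y)
    have := abs_le.1 this
    constructor <;> linarith

theorem IsCommonPair.higherTerms_nonneg (h : IsCommonPair G₁ G₂ p₁ p₂) (hsum : p₁ + p₂ = 1)
    (hp₁ : 0 < p₁) (hp₂ : 0 < p₂) (h₁ : eCount G₁ ≠ 0) (h₂ : eCount G₂ ≠ 0) {ε : ℝ}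
    (hε₁ : |ε| ≤ p₁) (hε₂ : |ε| ≤ p₂) (k : ℕ) :
    0 ≤ p₁ / eCount G₁ * higherTerms G₁ (ε / p₁) k +
      p₂ / eCount G₂ * higherTerms G₂ (-ε / p₂) k := by
  obtain ⟨φ, hφ, huniform⟩ := exists_measurable_uniform (Fin k → Fin 5)
  have := h _ _ (isGraphon_signPower hφ (ε := ε) (p := p₁) hε₁ (by linarith))
    (isGraphon_signPower hφ (ε := -ε) (p := p₂) (by rwa [abs_neg]) (by rw [abs_neg]; linarith))
    (fun x y => by linarith)
  rw [homDensity_signPower_div G₁ hφ huniform hp₁ h₁,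
    homDensity_signPower_div G₂ hφ huniform hp₂ h₂] at this
  linarith

end CommonPair

/-- If `(H₁,H₂)` is `(p₁,p₂)`-common, then both `H₁` and `H₂` are `K₄`-free. -/
theorem commonPair_K4_free {V₁ V₂ : Type*} [Fintype V₁] [Fintype V₂]
    (G₁ : SimpleGraph V₁) (G₂ : SimpleGraph V₂)
    (p₁ p₂ : ℝ) (hp₁ : p₁ ∈ Set.Ioo (0:ℝ) 1) (hp₂ : p₂ ∈ Set.Ioo (0:ℝ) 1)
    (hsum : p₁ + p₂ = 1)
    (hcommon : IsCommonPair G₁ G₂ p₁ p₂) :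
    G₁.CliqueFree 4 ∧ G₂.CliqueFree 4 := by
  by_cases h₁ : eCount G₁ = 0
  · exact ⟨cliqueFree_four_of_eCount_eq_zero h₁,
      cliqueFree_four_of_eCount_eq_zero (hcommon.eCount_eq_zero hp₂.1 h₁)⟩
  have h₂ : eCount G₂ ≠ 0 := fun h₂ => h₁ (hcommon.symm.eCount_eq_zero hp₁.1 h₂)
  have hε : 0 < min p₁ p₂ := lt_min hp₁.1 hp₂.1
  have hnonneg := hcommon.higherTerms_nonneg hsum hp₁.1 hp₂.1 h₁ h₂ (ε := min p₁ p₂)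
    (by rw [abs_of_pos hε]; exact min_le_left _ _) (by rw [abs_of_pos hε]; exact min_le_right _ _)
  obtain ⟨L₁, hL₁, hpos₁, hlim₁⟩ :=
    exists_tendsto_higherTerms G₁ (div_ne_zero hε.ne' hp₁.1.ne')
  obtain ⟨L₂, hL₂, hpos₂, hlim₂⟩ :=
    exists_tendsto_higherTerms G₂ (div_ne_zero (neg_ne_zero.2 hε.ne') hp₂.1.ne')
  have hc₁ : 0 < p₁ / eCount G₁ := div_pos hp₁.1 (by exact_mod_cast Nat.pos_of_ne_zero h₁)
  have hc₂ : 0 < p₂ / eCount G₂ := div_pos hp₂.1 (by exact_mod_cast Nat.pos_of_ne_zero h₂)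
  have hlim := ge_of_tendsto' ((hlim₁.const_mul (p₁ / eCount G₁)).add
    (hlim₂.const_mul (p₂ / eCount G₂))) (b := 0) fun n => by
      rw [← mul_div_assoc, ← mul_div_assoc, ← add_div]
      exact div_nonneg (hnonneg _) (by positivity)
  constructor <;> by_contra hfree
  · nlinarith [mul_pos hc₁ (hpos₁ hfree), mul_nonneg hc₂.le hL₂]
  · nlinarith [mul_pos hc₂ (hpos₂ hfree), mul_nonneg hc₁.le hL₁]
end
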